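/- arXiv:2309.12874 — 7 statements merged into one kernel-verified Lean document; each statement's English description precedes it below -/
import Mathlib

section
/- Let m ≥ 1 and ν ≥ 1 be integers and fix φ ∈ C^∞(ℝ^m, ℝ) with support in the open unit ball and ∫_{ℝ^m} φ = 1. There exists a constant C ∈ (0,∞), depending only on m and φ, such that for every λ ∈ [2,∞) and every bounded Borel measurable u : ℝ^m → ℝ^ν, the extension by averaging V of u satisfies ∫_1^λ Σ_{k∈ℤ} ∫_{[0,1]^m} Σ_{j∈ℤ^m} sup{ x_{m+1}^{m+1}·‖DV(x)‖^{m+1} : x ∈ ∂Q^+_{λ,τ,k,h,j} } dh (dτ/τ) ≤ C · ∬_{ℝ^m×ℝ^m} |u(y)−u(z)|^{m+1} / |y−z|^{2m} dy dz. -/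
open MeasureTheory Metric Set
open scoped ENNReal Topology

noncomputable section

abbrev Euc (m : ℕ) : Type := EuclideanSpace ℝ (Fin m)

/-- Truncated mean oscillation `MO_{δ,p} u (x', r)` of a map `u : ℝ^m → N`:
the double average over the ball of radius `r` centered at `x'` of
`(d(u y, u z) - δ)₊ ^ p`. -/
def MO {N : Type} [PseudoMetricSpace N] {m : ℕ} (p δ : ℝ) (u : Euc m → N)
    (x' : Euc m) (r : ℝ) : ℝ≥0∞ :=
  (volume (ball x' r))⁻¹ * (volume (ball x' r))⁻¹ *
    ∫⁻ y in ball x' r, ∫⁻ z in ball x' r,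
      ENNReal.ofReal (max (dist (u y) (u z) - δ) 0 ^ p)

/-- Truncated Gagliardo energy `∬ (d(u y, u z) - δ)₊^p / |y-z|^{2m}`. -/
def truncGagliardo {N : Type} [PseudoMetricSpace N] {m : ℕ} (p δ : ℝ)
    (u : Euc m → N) : ℝ≥0∞ :=
  ∫⁻ y, ∫⁻ z, ENNReal.ofReal (max (dist (u y) (u z) - δ) 0 ^ p) /
    ENNReal.ofReal (dist y z ^ (2 * m))

/-- The cube `r·([0,1]^m + c)` of edge length `r` in `ℝ^m`. -/
def cube (m : ℕ) (r : ℝ) (c : Fin m → ℝ) : Set (Euc m) :=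
  {x | ∀ i, x i ∈ Icc (r * c i) (r * (c i + 1))}


/-- The λ-adic cube `Q⁺_{λ,τ,k,h,j}` of the half-space `ℝ^m × (0,∞)`, with base
`τλ^{-k}([0,1]^m + c)` (where `c = j + h`) and height interval
`[τλ^{-k}/(λ-1), τλ^{-(k-1)}/(λ-1)]`. -/
def cubeQ (m : ℕ) (lam τ : ℝ) (k : ℤ) (c : Fin m → ℝ) : Set (Euc m × ℝ) :=
  cube m (τ * lam ^ (-k)) c ×ˢ
    Icc (τ * lam ^ (-k) / (lam - 1)) (τ * lam ^ (-(k - 1)) / (lam - 1))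

/-- Extension by averaging: `V(x', x_{m+1}) = ∫ u(x' - x_{m+1} z) φ(z) dz`. -/
def avgExt {m ν : ℕ} (φ : Euc m → ℝ) (u : Euc m → Euc ν) (x : Euc m × ℝ) : Euc ν :=
  ∫ z, φ z • u (x.1 - x.2 • z)

/-- The averaging kernel at the point `x` of the half-space. -/
def avgKernel {m : ℕ} (φ : Euc m → ℝ) (x : Euc m × ℝ) (y : Euc m) : ℝ :=
  x.2⁻¹ ^ m * φ (x.2⁻¹ • (x.1 - y))

lemma half_le_snd {m : ℕ} {x x₀ : Euc m × ℝ} (hx : ‖x - x₀‖ ≤ x₀.2 / 2) :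
    x₀.2 / 2 ≤ x.2 := by
  have h : |x.2 - x₀.2| ≤ x₀.2 / 2 := (norm_snd_le (x - x₀)).trans hx
  linarith [(abs_le.1 h).1]

lemma abs_avgKernel_sub_le {m : ℕ} {φ : Euc m → ℝ} {M L : ℝ} (hM : ∀ a, |φ a| ≤ M)
    (hL : ∀ a b, |φ a - φ b| ≤ L * ‖a - b‖) (hL0 : 0 ≤ L) {x x₀ : Euc m × ℝ} (hx₀ : 0 < x₀.2)
    (hx : ‖x - x₀‖ ≤ x₀.2 / 2) {y : Euc m} (hy : ‖x₀.1 - y‖ ≤ 2 * x₀.2) :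
    |avgKernel φ x y - avgKernel φ x₀ y| ≤
      (2 ^ m * m * M + 6 * L) * x₀.2⁻¹ ^ (m + 1) * ‖x - x₀‖ := by
  have hM0 : 0 ≤ M := (abs_nonneg _).trans (hM 0)
  have hxt := half_le_snd hx
  have hx2 : 0 < x.2 := by linarith
  set σ := x.2⁻¹ with hσ
  set σ₀ := x₀.2⁻¹ with hσ₀
  set δ := ‖x - x₀‖ with hδ
  have hσ₀pos : 0 < σ₀ := inv_pos.2 hx₀
  have hσpos : 0 < σ := inv_pos.2 hx2
  have hσle : σ ≤ 2 * σ₀ := by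
    rw [hσ, hσ₀, inv_le_comm₀ hx2 (by positivity)]
    simpa [mul_inv, div_eq_mul_inv, mul_comm] using hxt
  have hδ0 : 0 ≤ δ := norm_nonneg _
  have hd1 : ‖x.1 - x₀.1‖ ≤ δ := norm_fst_le (x - x₀)
  have hd2 : |x.2 - x₀.2| ≤ δ := norm_snd_le (x - x₀)
  have hσd : |σ - σ₀| ≤ 2 * σ₀ ^ 2 * δ := by
    have : σ - σ₀ = -(σ * σ₀ * (x.2 - x₀.2)) := by
      rw [hσ, hσ₀]; field_simp; ring
    rw [this, abs_neg, abs_mul, abs_of_pos (by positivity : 0 < σ * σ₀)]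
    calc σ * σ₀ * |x.2 - x₀.2| ≤ (2 * σ₀) * σ₀ * δ := by gcongr
      _ = _ := by ring
  have hpow : |σ ^ m - σ₀ ^ m| ≤ 2 ^ m * m * σ₀ ^ (m + 1) * δ := by
    rcases Nat.eq_zero_or_pos m with h0 | hmpos
    · subst h0; simp
    obtain ⟨n, rfl⟩ : ∃ n, m = n + 1 := ⟨m - 1, by omega⟩
    have hmax : max |σ| |σ₀| ≤ 2 * σ₀ := by
      rw [abs_of_pos hσpos, abs_of_pos hσ₀pos]
      exact max_le hσle (by linarith)
    calc |σ ^ (n + 1) - σ₀ ^ (n + 1)|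
        ≤ |σ - σ₀| * (n + 1 : ℕ) * max |σ| |σ₀| ^ (n + 1 - 1) := abs_pow_sub_pow_le _ _ _
      _ ≤ (2 * σ₀ ^ 2 * δ) * (n + 1 : ℕ) * (2 * σ₀) ^ (n + 1 - 1) := by gcongr
      _ = _ := by rw [Nat.add_sub_cancel]; ring
  have harg : ‖σ • (x.1 - y) - σ₀ • (x₀.1 - y)‖ ≤ 6 * σ₀ * δ := by
    have : σ • (x.1 - y) - σ₀ • (x₀.1 - y) = σ • (x.1 - x₀.1) + (σ - σ₀) • (x₀.1 - y) := by
      module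
    rw [this]
    refine (norm_add_le _ _).trans ?_
    rw [norm_smul, norm_smul, Real.norm_eq_abs, Real.norm_eq_abs, abs_of_pos hσpos]
    calc σ * ‖x.1 - x₀.1‖ + |σ - σ₀| * ‖x₀.1 - y‖
        ≤ (2 * σ₀) * δ + (2 * σ₀ ^ 2 * δ) * (2 * x₀.2) := by gcongr
      _ = 6 * σ₀ * δ := by
        have : σ₀ * x₀.2 = 1 := inv_mul_cancel₀ hx₀.ne'
        linear_combination 4 * σ₀ * δ * this
  have hsplit : avgKernel φ x y - avgKernel φ x₀ y =
      (σ ^ m - σ₀ ^ m) * φ (σ • (x.1 - y)) +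
        σ₀ ^ m * (φ (σ • (x.1 - y)) - φ (σ₀ • (x₀.1 - y))) := by
    simp only [avgKernel]; ring
  rw [hsplit]
  refine (abs_add_le _ _).trans ?_
  rw [abs_mul, abs_mul, abs_of_pos (pow_pos hσ₀pos m)]
  calc |σ ^ m - σ₀ ^ m| * |φ (σ • (x.1 - y))| +
        σ₀ ^ m * |φ (σ • (x.1 - y)) - φ (σ₀ • (x₀.1 - y))|
      ≤ (2 ^ m * m * σ₀ ^ (m + 1) * δ) * M + σ₀ ^ m * (L * (6 * σ₀ * δ)) := by
        gcongr
        · exact hM _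
        · exact (hL _ _).trans (by gcongr)
    _ = _ := by ring

lemma avgKernel_eq_zero {m : ℕ} {φ : Euc m → ℝ} (hsupp : ∀ a, 1 ≤ ‖a‖ → φ a = 0)
    {x : Euc m × ℝ} (hx : 0 < x.2) {y : Euc m} (hy : x.2 ≤ ‖x.1 - y‖) : avgKernel φ x y = 0 := by
  rw [avgKernel, hsupp, mul_zero]
  rw [norm_smul, norm_inv, Real.norm_of_nonneg hx.le, inv_mul_eq_div, one_le_div hx]
  exact hy

lemma integral_avgKernel_smul {m : ℕ} {F : Type*} [NormedAddCommGroup F] [NormedSpace ℝ F]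
    (φ : Euc m → ℝ) (v : Euc m → F) {x : Euc m × ℝ} (hx : 0 < x.2) :
    ∫ y, avgKernel φ x y • v y = ∫ z, φ z • v (x.1 - x.2 • z) := by
  set g : Euc m → F := fun z => φ z • v (x.1 - x.2 • z) with hg
  have h1 : ∀ y, avgKernel φ x y • v y = x.2⁻¹ ^ m • g (x.2⁻¹ • (x.1 - y)) := by
    intro y
    simp only [hg, avgKernel, smul_smul, mul_inv_cancel₀ hx.ne', one_smul, sub_sub_cancel]
  simp_rw [h1]
  rw [integral_smul, integral_sub_left_eq_self (fun y => g (x.2⁻¹ • y)),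
    Measure.integral_comp_smul, smul_smul, finrank_euclideanSpace_fin, abs_of_pos (by positivity),
    mul_inv_cancel₀ (by positivity), one_smul]

lemma integrable_avgKernel {m : ℕ} {φ : Euc m → ℝ} (hφ : Integrable φ) {x : Euc m × ℝ}
    (hx : 0 < x.2) : Integrable (avgKernel φ x) := by
  have h := (hφ.comp_smul (inv_ne_zero hx.ne')).comp_sub_left x.1
  exact h.const_mul _

lemma avgExt_sub_avgExt {m ν : ℕ} {φ : Euc m → ℝ} (hφ : Integrable φ) {u : Euc m → Euc ν}
    (hu : Measurable u) {B : ℝ} (hB : ∀ x, ‖u x‖ ≤ B) (c : Euc ν) {x x₀ : Euc m × ℝ}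
    (hx : 0 < x.2) (hx₀ : 0 < x₀.2) :
    avgExt φ u x - avgExt φ u x₀ =
      ∫ y, (avgKernel φ x y - avgKernel φ x₀ y) • (u y - c) := by
  have hint : ∀ x : Euc m × ℝ, 0 < x.2 → Integrable (fun y => avgKernel φ x y • (u y - c)) := by
    intro x hx
    refine (integrable_avgKernel hφ hx).smul_bdd (B + ‖c‖)
      (hu.sub_const c).aestronglyMeasurable (.of_forall fun y => ?_)
    exact (norm_sub_le _ _).trans (by gcongr; exact hB y)
  have hintu : ∀ x : Euc m × ℝ, 0 < x.2 → Integrable (fun y => avgKernel φ x y • u y) :=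
    fun x hx => (integrable_avgKernel hφ hx).smul_bdd B
      hu.aestronglyMeasurable (.of_forall hB)
  have key : ∀ x : Euc m × ℝ, 0 < x.2 →
      ∫ y, avgKernel φ x y • (u y - c) = avgExt φ u x - (∫ z, φ z) • c := by
    intro x hx
    simp_rw [smul_sub]
    rw [integral_sub (hintu x hx) ((integrable_avgKernel hφ hx).smul_const c),
      integral_avgKernel_smul φ u hx, integral_avgKernel_smul φ (fun _ => c) hx,
      integral_smul_const, avgExt]
  simp_rw [sub_smul]
  rw [integral_sub (hint x hx) (hint x₀ hx₀), key x hx, key x₀ hx₀]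
  abel

lemma norm_fderiv_avgExt_le {m ν : ℕ} {φ : Euc m → ℝ} (hφ : Integrable φ) {M L : ℝ}
    (hM : ∀ a, |φ a| ≤ M) (hL : ∀ a b, |φ a - φ b| ≤ L * ‖a - b‖) (hL0 : 0 ≤ L)
    (hsupp : ∀ a, 1 ≤ ‖a‖ → φ a = 0) {u : Euc m → Euc ν}
    (hu : Measurable u) {B : ℝ} (hB : ∀ x, ‖u x‖ ≤ B) (c : Euc ν) {x₀ : Euc m × ℝ}
    (hx₀ : 0 < x₀.2) :
    ‖fderiv ℝ (avgExt φ u) x₀‖ ≤ (2 ^ m * m * M + 6 * L) * x₀.2⁻¹ ^ (m + 1) *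
      ∫ y in closedBall x₀.1 (2 * x₀.2), ‖u y - c‖ := by
  have hM0 : 0 ≤ M := (abs_nonneg _).trans (hM 0)
  refine norm_fderiv_le_of_lip' ℝ (by positivity) ?_
  filter_upwards [closedBall_mem_nhds x₀ (half_pos hx₀)] with x hx
  rw [mem_closedBall, dist_eq_norm] at hx
  have hxt := half_le_snd hx
  have hx2 : 0 < x.2 := by linarith
  have hd1 : ‖x.1 - x₀.1‖ ≤ x₀.2 / 2 := (norm_fst_le (x - x₀)).trans hx
  have hd2 : |x.2 - x₀.2| ≤ x₀.2 / 2 := (norm_snd_le (x - x₀)).trans hx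
  rw [avgExt_sub_avgExt hφ hu hB c hx2 hx₀]
  have hsup : Function.support (fun y => (avgKernel φ x y - avgKernel φ x₀ y) • (u y - c)) ⊆
      closedBall x₀.1 (2 * x₀.2) := by
    intro y hy
    by_contra hy'
    rw [mem_closedBall', dist_eq_norm, not_le] at hy'
    refine hy ?_
    have h1 : ‖x₀.1 - y‖ ≤ ‖x.1 - y‖ + ‖x.1 - x₀.1‖ := by
      rw [norm_sub_rev x.1 x₀.1, add_comm]; exact norm_sub_le_norm_sub_add_norm_sub _ _ _
    have h2 := (abs_le.1 hd2).2
    simp only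
    rw [avgKernel_eq_zero hsupp hx2 (by linarith), avgKernel_eq_zero hsupp hx₀ (by linarith)]
    simp
  rw [← setIntegral_eq_integral_of_forall_compl_eq_zero
    (fun y hy => Function.notMem_support.1 fun h => hy (hsup h))]
  refine (norm_integral_le_integral_norm _).trans ?_
  have hbi : IntegrableOn (fun y => ‖u y - c‖) (closedBall x₀.1 (2 * x₀.2)) := by
    refine Measure.integrableOn_of_bounded (M := B + ‖c‖) measure_closedBall_lt_top.ne
      (hu.sub_const c).norm.aestronglyMeasurable (.of_forall fun y => ?_)
    rw [norm_norm]
    exact (norm_sub_le _ _).trans (by gcongr; exact hB y)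
  rw [mul_right_comm, ← integral_const_mul]
  refine setIntegral_mono_on₀ ?_ (hbi.const_mul _) measurableSet_closedBall.nullMeasurableSet ?_
  · have := ((integrable_avgKernel hφ hx2).sub (integrable_avgKernel hφ hx₀)).smul_bdd
      (B + ‖c‖) (hu.sub_const c).aestronglyMeasurable
      (.of_forall fun y => (norm_sub_le _ _).trans (by gcongr; exact hB y))
    exact this.norm.integrableOn
  · intro y hy
    rw [mem_closedBall', dist_eq_norm] at hy
    rw [norm_smul]
    gcongr
    exact abs_avgKernel_sub_le hM hL hL0 hx₀ hx hy

lemma lintegral_pow_le_measure_pow_mul {α : Type*} [MeasurableSpace α] {μ : Measure α} (n : ℕ)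
    {f : α → ℝ≥0∞} (hf : AEMeasurable f μ) :
    (∫⁻ a, f a ∂μ) ^ (n + 1) ≤ μ univ ^ n * ∫⁻ a, f a ^ (n + 1) ∂μ := by
  have hq : (0 : ℝ) < (n + 1 : ℕ) := by positivity
  have h := eLpNorm'_le_eLpNorm'_mul_rpow_measure_univ (μ := μ) (f := f) (p := 1)
    (q := ((n + 1 : ℕ) : ℝ)) one_pos (by simp) hf.aestronglyMeasurable
  simp only [eLpNorm'_eq_lintegral_enorm, enorm_eq_self, ENNReal.rpow_one,
    div_one, ENNReal.rpow_natCast] at h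
  calc (∫⁻ a, f a ∂μ) ^ (n + 1)
      ≤ ((∫⁻ a, f a ^ (n + 1) ∂μ) ^ (1 / ((n + 1 : ℕ) : ℝ)) *
          μ univ ^ (1 - 1 / ((n + 1 : ℕ) : ℝ))) ^ (n + 1) := by gcongr
    _ = μ univ ^ n * ∫⁻ a, f a ^ (n + 1) ∂μ := by
      rw [mul_pow, ← ENNReal.rpow_natCast, ← ENNReal.rpow_natCast, ← ENNReal.rpow_mul,
        ← ENNReal.rpow_mul, one_div_mul_cancel hq.ne', ENNReal.rpow_one, sub_mul,
        one_div_mul_cancel hq.ne', mul_comm, ← ENNReal.rpow_natCast (μ univ) n]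
      congr 2
      push_cast; ring

/-- The numerator of the Gagliardo energy density. -/
def oscPow {m ν : ℕ} (u : Euc m → Euc ν) (q : Euc m × Euc m) : ℝ≥0∞ :=
  ENNReal.ofReal (dist (u q.1) (u q.2) ^ (m + 1))

lemma measurable_oscPow {m ν : ℕ} {u : Euc m → Euc ν} (hu : Measurable u) :
    Measurable (oscPow u) :=
  (((hu.comp measurable_fst).dist (hu.comp measurable_snd)).pow_const _).ennreal_ofReal

lemma volume_closedBall_euc {m : ℕ} (a : Euc m) {r : ℝ} (hr : 0 ≤ r) :
    volume (closedBall a r) =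
      ENNReal.ofReal (r ^ m * volume.real (ball (0 : Euc m) 1)) := by
  rw [Measure.addHaar_closedBall _ _ hr, finrank_euclideanSpace_fin,
    ENNReal.ofReal_mul (by positivity), ofReal_measureReal measure_ball_lt_top.ne]

lemma volume_real_unit_ball_pos (m : ℕ) : 0 < volume.real (ball (0 : Euc m) 1) :=
  ENNReal.toReal_pos (measure_ball_pos _ _ one_pos).ne' measure_ball_lt_top.ne

lemma ofReal_fderiv_avgExt_pow_le {m ν : ℕ} {φ : Euc m → ℝ} {u : Euc m → Euc ν}
    (hu : Measurable u) {B : ℝ} (hB : ∀ x, ‖u x‖ ≤ B) {K : ℝ} (hK : 0 ≤ K) {x : Euc m × ℝ}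
    (hx : 0 < x.2)
    (hD : ∀ c : Euc ν, ‖fderiv ℝ (avgExt φ u) x‖ ≤ K * x.2⁻¹ ^ (m + 1) *
      ∫ y in closedBall x.1 (2 * x.2), ‖u y - c‖) :
    ENNReal.ofReal (x.2 ^ (m + 1) * ‖fderiv ℝ (avgExt φ u) x‖ ^ (m + 1)) ≤
      ENNReal.ofReal (K ^ (m + 1) * (2 ^ m * volume.real (ball (0 : Euc m) 1)) ^ m /
        (2 ^ m * volume.real (ball (0 : Euc m) 1)) * x.2⁻¹ ^ (2 * m)) *
      ∫⁻ q in closedBall x.1 (2 * x.2) ×ˢ closedBall x.1 (2 * x.2), oscPow u q := by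
  set ω := volume.real (ball (0 : Euc m) 1)
  have hω : 0 < ω := volume_real_unit_ball_pos m
  set t := x.2
  set S := closedBall x.1 (2 * t)
  set D := ‖fderiv ℝ (avgExt φ u) x‖
  have hvol : volume S = ENNReal.ofReal ((2 * t) ^ m * ω) :=
    volume_closedBall_euc _ (by positivity)
  have hz : ∀ z, ENNReal.ofReal (t ^ (m + 1) * D ^ (m + 1)) ≤
      ENNReal.ofReal ((K * t⁻¹ ^ m) ^ (m + 1) * ((2 * t) ^ m * ω) ^ m) *
        ∫⁻ y in S, oscPow u (y, z) := by
    intro z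
    have hbi : IntegrableOn (fun y => ‖u y - u z‖) S := by
      refine Measure.integrableOn_of_bounded (M := B + ‖u z‖) measure_closedBall_lt_top.ne
        (hu.sub_const _).norm.aestronglyMeasurable (.of_forall fun y => ?_)
      rw [norm_norm]
      exact (norm_sub_le _ _).trans (by gcongr; exact hB y)
    have h1 : t * D ≤ K * t⁻¹ ^ m * ∫ y in S, ‖u y - u z‖ := by
      calc t * D ≤ t * (K * t⁻¹ ^ (m + 1) * ∫ y in S, ‖u y - u z‖) := by
            gcongr; exact hD (u z)
        _ = _ := by simp only [inv_pow, pow_succ]; field_simp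
    have h2 : ENNReal.ofReal (t * D) ≤
        ENNReal.ofReal (K * t⁻¹ ^ m) * ∫⁻ y in S, ENNReal.ofReal ‖u y - u z‖ := by
      rw [← ofReal_integral_eq_lintegral_ofReal hbi (.of_forall fun _ => norm_nonneg _),
        ← ENNReal.ofReal_mul (by positivity)]
      exact ENNReal.ofReal_le_ofReal h1
    calc ENNReal.ofReal (t ^ (m + 1) * D ^ (m + 1)) = ENNReal.ofReal (t * D) ^ (m + 1) := by
          rw [← ENNReal.ofReal_pow (by positivity), mul_pow]
      _ ≤ (ENNReal.ofReal (K * t⁻¹ ^ m) * ∫⁻ y in S, ENNReal.ofReal ‖u y - u z‖) ^ (m + 1) := by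
          gcongr
      _ ≤ ENNReal.ofReal (K * t⁻¹ ^ m) ^ (m + 1) *
          (volume.restrict S univ ^ m * ∫⁻ y in S, ENNReal.ofReal ‖u y - u z‖ ^ (m + 1)) := by
          rw [mul_pow]
          gcongr
          exact lintegral_pow_le_measure_pow_mul m
            (hu.sub_const _).norm.ennreal_ofReal.aemeasurable
      _ = _ := by
          rw [Measure.restrict_apply_univ, hvol, ← mul_assoc, ← ENNReal.ofReal_pow (by positivity),
            ← ENNReal.ofReal_pow (by positivity), ← ENNReal.ofReal_mul (by positivity)]
          simp_rw [oscPow, dist_eq_norm, ← ENNReal.ofReal_pow (norm_nonneg _)]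
  have hint : volume S * ENNReal.ofReal (t ^ (m + 1) * D ^ (m + 1)) ≤
      ENNReal.ofReal ((K * t⁻¹ ^ m) ^ (m + 1) * ((2 * t) ^ m * ω) ^ m) *
        ∫⁻ q in S ×ˢ S, oscPow u q := by
    rw [Measure.volume_eq_prod, setLIntegral_prod_symm _ (measurable_oscPow hu).aemeasurable,
      ← lintegral_const_mul' _ _ ENNReal.ofReal_ne_top, mul_comm, ← setLIntegral_const]
    exact lintegral_mono fun z => hz z
  calc ENNReal.ofReal (t ^ (m + 1) * D ^ (m + 1))
      = ENNReal.ofReal ((2 * t) ^ m * ω)⁻¹ *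
          (volume S * ENNReal.ofReal (t ^ (m + 1) * D ^ (m + 1))) := by
        rw [hvol, ← mul_assoc, ← ENNReal.ofReal_mul (by positivity),
          inv_mul_cancel₀ (by positivity), ENNReal.ofReal_one, one_mul]
    _ ≤ ENNReal.ofReal ((2 * t) ^ m * ω)⁻¹ *
          (ENNReal.ofReal ((K * t⁻¹ ^ m) ^ (m + 1) * ((2 * t) ^ m * ω) ^ m) *
        ∫⁻ q in S ×ˢ S, oscPow u q) := by gcongr
    _ = _ := by
        rw [← mul_assoc, ← ENNReal.ofReal_mul (by positivity)]
        congr 2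
        simp only [inv_pow, mul_pow, ← pow_mul, pow_succ]
        field_simp
        ring

/-- The energy density on the half-space at the point `p`. -/
def oscDensity {m ν : ℕ} (u : Euc m → Euc ν) (p : Euc m × ℝ) : ℝ≥0∞ :=
  ENNReal.ofReal (p.2⁻¹ ^ (3 * m + 1)) *
    ∫⁻ q in closedBall p.1 (3 * p.2) ×ˢ closedBall p.1 (3 * p.2), oscPow u q

lemma measurableSet_closedBall_prod (m : ℕ) : MeasurableSet
    {w : (Euc m × ℝ) × (Euc m × Euc m) |
      w.2 ∈ closedBall w.1.1 (3 * w.1.2) ×ˢ closedBall w.1.1 (3 * w.1.2)} := by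
  simp only [mem_prod, mem_closedBall]
  have h1 : Measurable fun w : (Euc m × ℝ) × (Euc m × Euc m) => dist w.2.1 w.1.1 := by fun_prop
  have h2 : Measurable fun w : (Euc m × ℝ) × (Euc m × Euc m) => dist w.2.2 w.1.1 := by fun_prop
  have h3 : Measurable fun w : (Euc m × ℝ) × (Euc m × Euc m) => 3 * w.1.2 := by fun_prop
  exact (measurableSet_le h1 h3).inter (measurableSet_le h2 h3)

lemma oscDensity_eq {m ν : ℕ} (u : Euc m → Euc ν) (p : Euc m × ℝ) :
    oscDensity u p = ENNReal.ofReal (p.2⁻¹ ^ (3 * m + 1)) *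
      ∫⁻ q, indicator {w : (Euc m × ℝ) × (Euc m × Euc m) |
        w.2 ∈ closedBall w.1.1 (3 * w.1.2) ×ˢ closedBall w.1.1 (3 * w.1.2)}
        (fun w => oscPow u w.2) (p, q) := by
  rw [oscDensity, ← lintegral_indicator (measurableSet_closedBall.prod measurableSet_closedBall)]
  rfl

lemma measurable_oscDensity {m ν : ℕ} {u : Euc m → Euc ν} (hu : Measurable u) :
    Measurable (oscDensity u) := by
  rw [funext (oscDensity_eq u)]
  refine Measurable.mul (by fun_prop) (Measurable.lintegral_prod_right' ?_)
  exact ((measurable_oscPow hu).comp measurable_snd).indicator (measurableSet_closedBall_prod m)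

lemma ofReal_mul_lintegral_le_lintegral_oscDensity {m ν : ℕ} (u : Euc m → Euc ν)
    {x : Euc m × ℝ} (hx : 0 < x.2) :
    ENNReal.ofReal (volume.real (ball (0 : Euc m) 1) / 2 ^ (3 * m + 1) * x.2⁻¹ ^ (2 * m)) *
      ∫⁻ q in closedBall x.1 (2 * x.2) ×ˢ closedBall x.1 (2 * x.2), oscPow u q ≤
    ∫⁻ p in closedBall x.1 x.2 ×ˢ Icc x.2 (2 * x.2), oscDensity u p := by
  set ω := volume.real (ball (0 : Euc m) 1)
  have hω : 0 < ω := volume_real_unit_ball_pos m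
  set I := ∫⁻ q in closedBall x.1 (2 * x.2) ×ˢ closedBall x.1 (2 * x.2), oscPow u q
  have hmeas : MeasurableSet (closedBall x.1 x.2 ×ˢ Icc x.2 (2 * x.2)) :=
    measurableSet_closedBall.prod measurableSet_Icc
  have hlow : ∀ p ∈ closedBall x.1 x.2 ×ˢ Icc x.2 (2 * x.2),
      ENNReal.ofReal ((2 * x.2)⁻¹ ^ (3 * m + 1)) * I ≤ oscDensity u p := by
    rintro p ⟨hp1, hp2, hp3⟩
    have hp0 : 0 < p.2 := hx.trans_le hp2
    have hsub : closedBall x.1 (2 * x.2) ⊆ closedBall p.1 (3 * p.2) :=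
      closedBall_subset_closedBall' (by rw [mem_closedBall, dist_comm] at hp1; linarith)
    rw [oscDensity]
    gcongr
    exact lintegral_mono_set (prod_mono hsub hsub)
  have hvol : volume (closedBall x.1 x.2 ×ˢ Icc x.2 (2 * x.2)) =
      ENNReal.ofReal (x.2 ^ m * ω * x.2) := by
    rw [Measure.volume_eq_prod, Measure.prod_prod, volume_closedBall_euc _ hx.le, Real.volume_Icc,
      ← ENNReal.ofReal_mul (by positivity)]
    congr 1; ring
  calc _ = (ENNReal.ofReal ((2 * x.2)⁻¹ ^ (3 * m + 1)) * I) *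
        volume (closedBall x.1 x.2 ×ˢ Icc x.2 (2 * x.2)) := by
        rw [hvol, mul_right_comm, ← ENNReal.ofReal_mul (by positivity)]
        congr 2
        simp only [inv_pow, mul_pow, pow_succ]
        field_simp
        ring
    _ = ∫⁻ _ in closedBall x.1 x.2 ×ˢ Icc x.2 (2 * x.2),
        ENNReal.ofReal ((2 * x.2)⁻¹ ^ (3 * m + 1)) * I := (setLIntegral_const _ _).symm
    _ ≤ _ := setLIntegral_mono' hmeas hlow

lemma lintegral_Ioi_inv_pow {a : ℝ} (ha : 0 < a) {n : ℕ} (hn : 1 ≤ n) :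
    ∫⁻ s in Ioi a, ENNReal.ofReal (s⁻¹ ^ (n + 1)) = ENNReal.ofReal (a⁻¹ ^ n / n) := by
  have hn' : (1 : ℝ) ≤ n := by exact_mod_cast hn
  have hlt : (-((n : ℝ) + 1)) < -1 := by linarith
  have hrw : ∀ s ∈ Ioi a, s⁻¹ ^ (n + 1) = s ^ (-((n : ℝ) + 1)) := by
    intro s hs
    have hs0 : 0 < s := ha.trans hs
    rw [Real.rpow_neg hs0.le, inv_pow, ← Real.rpow_natCast]
    push_cast; rfl
  rw [setLIntegral_congr_fun measurableSet_Ioi fun s hs => by rw [hrw s hs],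
    ← ofReal_integral_eq_lintegral_ofReal (integrableOn_Ioi_rpow_of_lt hlt ha)
      ((ae_restrict_mem measurableSet_Ioi).mono fun s hs => Real.rpow_nonneg (ha.trans hs).le _),
    integral_Ioi_rpow_of_lt hlt ha]
  congr 1
  rw [show -((n : ℝ) + 1) + 1 = -n by ring, Real.rpow_neg ha.le, Real.rpow_natCast, inv_pow]
  field_simp

lemma lintegral_closedBall_prod_le {m : ℕ} (hm : 1 ≤ m) {y z : Euc m} (hyz : y ≠ z) :
    ∫⁻ p in {p : Euc m × ℝ | 0 < p.2}, indicator {p : Euc m × ℝ |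
        (y, z) ∈ closedBall p.1 (3 * p.2) ×ˢ closedBall p.1 (3 * p.2)}
        (fun p => ENNReal.ofReal (p.2⁻¹ ^ (3 * m + 1))) p ≤
      ENNReal.ofReal (3 ^ m * volume.real (ball (0 : Euc m) 1) * 7 ^ (2 * m)) *
        (ENNReal.ofReal (dist y z ^ (2 * m)))⁻¹ := by
  set ω := volume.real (ball (0 : Euc m) 1)
  have hω : 0 < ω := volume_real_unit_ball_pos m
  have hd : 0 < dist y z := dist_pos.2 hyz
  set T : Set (Euc m × ℝ) := {p | p.1 ∈ closedBall y (3 * p.2) ∧ dist y z / 7 < p.2} with hT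
  have hTm : MeasurableSet T := by
    have h1 : Measurable fun p : Euc m × ℝ => dist p.1 y := by fun_prop
    have h2 : Measurable fun p : Euc m × ℝ => 3 * p.2 := by fun_prop
    have h3 : Measurable fun p : Euc m × ℝ => p.2 := by fun_prop
    exact (measurableSet_le h1 h2).inter (measurableSet_lt measurable_const h3)
  set g : Euc m × ℝ → ℝ≥0∞ := fun p => ENNReal.ofReal (p.2⁻¹ ^ (3 * m + 1))
  have hg : Measurable g := by fun_prop
  have hpos : MeasurableSet {p : Euc m × ℝ | 0 < p.2} :=
    measurableSet_lt measurable_const measurable_snd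
  calc _ ≤ ∫⁻ p, T.indicator g p := by
        rw [← lintegral_indicator hpos]
        refine lintegral_mono fun p => ?_
        rw [indicator_indicator]
        refine indicator_le_indicator_of_subset ?_ (fun _ => zero_le) p
        rintro p ⟨hp0, hy, hz⟩
        simp only [mem_ofPred_eq, mem_closedBall] at hp0 hy hz
        refine ⟨by rw [mem_closedBall']; exact hy, ?_⟩
        have := dist_triangle_right y z p.1
        linarith
    _ = ∫⁻ s, ∫⁻ w, T.indicator g (w, s) := by
        rw [Measure.volume_eq_prod, lintegral_prod_symm _ (hg.indicator hTm).aemeasurable]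
    _ = ∫⁻ s in Ioi (dist y z / 7),
          ENNReal.ofReal (3 ^ m * ω) * ENNReal.ofReal (s⁻¹ ^ (2 * m + 1)) := by
        rw [← lintegral_indicator measurableSet_Ioi]
        refine lintegral_congr fun s => ?_
        by_cases hs : s ∈ Ioi (dist y z / 7)
        · have hs0 : 0 < s := lt_trans (by positivity) hs
          rw [indicator_of_mem hs]
          have : ∀ w, T.indicator g (w, s) = (closedBall y (3 * s)).indicator
              (fun _ => ENNReal.ofReal (s⁻¹ ^ (3 * m + 1))) w := by
            intro w
            by_cases hw : w ∈ closedBall y (3 * s)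
            · rw [indicator_of_mem hw, indicator_of_mem (show (w, s) ∈ T from ⟨hw, hs⟩)]
            · rw [indicator_of_notMem hw, indicator_of_notMem fun h => hw h.1]
          simp_rw [this]
          rw [lintegral_indicator measurableSet_closedBall, setLIntegral_const,
            volume_closedBall_euc _ (by positivity), ← ENNReal.ofReal_mul (by positivity),
            ← ENNReal.ofReal_mul (by positivity)]
          congr 1
          simp only [inv_pow, mul_pow, pow_succ]
          field_simp
          ring
        · rw [indicator_of_notMem hs]
          have : ∀ w, T.indicator g (w, s) = 0 := fun w => indicator_of_notMem (fun h => hs h.2) _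
          simp_rw [this, lintegral_zero]
    _ = ENNReal.ofReal (3 ^ m * ω) *
          ENNReal.ofReal ((dist y z / 7)⁻¹ ^ (2 * m) / (2 * m : ℕ)) := by
        rw [lintegral_const_mul' _ _ ENNReal.ofReal_ne_top,
          lintegral_Ioi_inv_pow (by positivity) (by omega)]
    _ ≤ _ := by
        rw [← ENNReal.ofReal_inv_of_pos (by positivity), ← ENNReal.ofReal_mul (by positivity),
          ← ENNReal.ofReal_mul (by positivity)]
        refine ENNReal.ofReal_le_ofReal ?_
        have : (1 : ℝ) ≤ (2 * m : ℕ) := by exact_mod_cast (by omega : 1 ≤ 2 * m)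
        calc 3 ^ m * ω * ((dist y z / 7)⁻¹ ^ (2 * m) / (2 * m : ℕ))
            ≤ 3 ^ m * ω * (dist y z / 7)⁻¹ ^ (2 * m) := by
              gcongr; exact div_le_self (by positivity) this
          _ = _ := by rw [inv_div, div_pow]; field_simp

lemma lintegral_oscDensity_le {m ν : ℕ} (hm : 1 ≤ m) {u : Euc m → Euc ν} (hu : Measurable u) :
    ∫⁻ p in {p : Euc m × ℝ | 0 < p.2}, oscDensity u p ≤
      ENNReal.ofReal (3 ^ m * volume.real (ball (0 : Euc m) 1) * 7 ^ (2 * m)) *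
        ∫⁻ y, ∫⁻ z, ENNReal.ofReal (dist (u y) (u z) ^ (m + 1)) /
          ENNReal.ofReal (dist y z ^ (2 * m)) := by
  set W : Set ((Euc m × ℝ) × (Euc m × Euc m)) :=
    {w | w.2 ∈ closedBall w.1.1 (3 * w.1.2) ×ˢ closedBall w.1.1 (3 * w.1.2)}
  have hW : MeasurableSet W := measurableSet_closedBall_prod m
  have hdiv : Measurable fun q : Euc m × Euc m =>
      oscPow u q / ENNReal.ofReal (dist q.1 q.2 ^ (2 * m)) :=
    (measurable_oscPow hu).div (by fun_prop)
  have hG : Measurable fun e : (Euc m × ℝ) × (Euc m × Euc m) =>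
      oscPow u e.2 * W.indicator (fun e => ENNReal.ofReal (e.1.2⁻¹ ^ (3 * m + 1))) e :=
    ((measurable_oscPow hu).comp measurable_snd).mul (Measurable.indicator (by fun_prop) hW)
  have hrhs : ∫⁻ y, ∫⁻ z, ENNReal.ofReal (dist (u y) (u z) ^ (m + 1)) /
      ENNReal.ofReal (dist y z ^ (2 * m)) =
      ∫⁻ q : Euc m × Euc m, oscPow u q / ENNReal.ofReal (dist q.1 q.2 ^ (2 * m)) := by
    rw [Measure.volume_eq_prod, lintegral_prod _ hdiv.aemeasurable]
    rfl
  calc _ = ∫⁻ p in {p : Euc m × ℝ | 0 < p.2}, ∫⁻ q,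
        oscPow u q * W.indicator (fun e => ENNReal.ofReal (e.1.2⁻¹ ^ (3 * m + 1))) (p, q) := by
        refine lintegral_congr fun p => ?_
        rw [oscDensity_eq, ← lintegral_const_mul' _ _ ENNReal.ofReal_ne_top]
        refine lintegral_congr fun q => ?_
        by_cases h : (p, q) ∈ W
        · rw [indicator_of_mem h, indicator_of_mem h, mul_comm]
        · rw [indicator_of_notMem h, indicator_of_notMem h, mul_zero, mul_zero]
    _ = ∫⁻ q, ∫⁻ p in {p : Euc m × ℝ | 0 < p.2},
        oscPow u q * W.indicator (fun e => ENNReal.ofReal (e.1.2⁻¹ ^ (3 * m + 1))) (p, q) :=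
        lintegral_lintegral_swap hG.aemeasurable
    _ ≤ ∫⁻ q : Euc m × Euc m,
        ENNReal.ofReal (3 ^ m * volume.real (ball (0 : Euc m) 1) * 7 ^ (2 * m)) *
        (oscPow u q / ENNReal.ofReal (dist q.1 q.2 ^ (2 * m))) := by
        refine lintegral_mono fun ⟨y, z⟩ => ?_
        by_cases hyz : y = z
        · subst hyz
          have : oscPow u (y, y) = 0 := by simp [oscPow]
          simp [this]
        · have hmW : Measurable fun p : Euc m × ℝ => W.indicator
              (fun e => ENNReal.ofReal (e.1.2⁻¹ ^ (3 * m + 1))) (p, (y, z)) :=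
            (Measurable.indicator (by fun_prop) hW).comp (by fun_prop)
          simp only
          rw [lintegral_const_mul _ hmW, div_eq_mul_inv, mul_left_comm]
          gcongr
          exact lintegral_closedBall_prod_le hm hyz
    _ = _ := by rw [lintegral_const_mul _ hdiv, hrhs]

lemma tsum_lintegral_Ioc_zpow_le {lam : ℝ} (hlam : 1 < lam) {f : ℝ → ℝ≥0∞} :
    ∑' k : ℤ, ∫⁻ τ in Ioc (1 : ℝ) lam, f (τ * lam ^ (-k)) * ENNReal.ofReal τ⁻¹ ≤
      ∫⁻ r in Ioi (0 : ℝ), f r * ENNReal.ofReal r⁻¹ := by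
  have hlam0 : 0 < lam := by linarith
  have hstep : ∀ k : ℤ, ∫⁻ τ in Ioc (1 : ℝ) lam, f (τ * lam ^ (-k)) * ENNReal.ofReal τ⁻¹ ≤
      ∫⁻ r in Ioc (lam ^ (-k)) (lam ^ (-k + 1)), f r * ENNReal.ofReal r⁻¹ := by
    intro k
    have ha : 0 < lam ^ (-k) := zpow_pos hlam0 _
    have himg := lintegral_image_eq_lintegral_abs_deriv_mul (s := Ioc (1 : ℝ) lam)
      (f := fun τ => τ * lam ^ (-k)) (f' := fun _ => lam ^ (-k)) measurableSet_Ioc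
      (fun τ _ => (hasDerivAt_mul_const _).hasDerivWithinAt)
      (mul_left_injective₀ ha.ne').injOn (fun r => f r * ENNReal.ofReal r⁻¹)
    calc _ = ∫⁻ r in (fun τ => τ * lam ^ (-k)) '' Ioc (1 : ℝ) lam, f r * ENNReal.ofReal r⁻¹ := by
          rw [himg]
          refine setLIntegral_congr_fun measurableSet_Ioc fun τ hτ => ?_
          have hτ0 : 0 < τ := one_pos.trans hτ.1
          rw [mul_left_comm, ← ENNReal.ofReal_mul (abs_nonneg _), abs_of_pos ha]
          congr 2
          field_simp
      _ ≤ _ := by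
          refine lintegral_mono_set ?_
          rintro _ ⟨τ, hτ, rfl⟩
          refine ⟨lt_mul_of_one_lt_left ha hτ.1, ?_⟩
          rw [zpow_add_one₀ hlam0.ne', mul_comm]
          exact mul_le_mul_of_nonneg_right hτ.2 ha.le
  have hdisj : Pairwise (Function.onFun Disjoint fun k : ℤ => Ioc (lam ^ k) (lam ^ (k + 1))) := by
    simpa using (zpow_right_strictMono₀ hlam).monotone.pairwise_disjoint_on_Ioc_succ
  calc _ ≤ ∑' k : ℤ, ∫⁻ r in Ioc (lam ^ (-k)) (lam ^ (-k + 1)), f r * ENNReal.ofReal r⁻¹ :=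
        ENNReal.tsum_le_tsum hstep
    _ = ∑' k : ℤ, ∫⁻ r in Ioc (lam ^ k) (lam ^ (k + 1)), f r * ENNReal.ofReal r⁻¹ :=
        (Equiv.neg ℤ).tsum_eq fun k : ℤ =>
          ∫⁻ r in Ioc (lam ^ k) (lam ^ (k + 1)), f r * ENNReal.ofReal r⁻¹
    _ = ∫⁻ r in ⋃ k : ℤ, Ioc (lam ^ k) (lam ^ (k + 1)), f r * ENNReal.ofReal r⁻¹ :=
        (lintegral_iUnion (fun _ => measurableSet_Ioc) hdisj _).symm
    _ ≤ _ := lintegral_mono_set (iUnion_subset fun k r hr => (zpow_pos hlam0 k).trans hr.1)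

lemma lintegral_Icc_tsum_intCast_add_le {ι : Type*} [Fintype ι] {f : (ι → ℝ) → ℝ≥0∞}
    (hf : Measurable f) :
    ∫⁻ h in Icc (0 : ι → ℝ) 1, ∑' j : ι → ℤ, f (fun i => (j i : ℝ) + h i) ≤ ∫⁻ c, f c := by
  set U : Set (ι → ℝ) := univ.pi fun _ => Ico 0 1
  have hU : MeasurableSet U := .univ_pi fun _ => measurableSet_Ico
  set v : (ι → ℤ) → ι → ℝ := fun j i => (j i : ℝ)
  set P : (ι → ℤ) → Set (ι → ℝ) := fun j => (fun c => c - v j) ⁻¹' U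
  have hP : ∀ j, MeasurableSet (P j) := fun j => (measurable_id.sub_const _) hU
  have hterm : ∀ j : ι → ℤ, ∫⁻ h in U, f (v j + h) = ∫⁻ c in P j, f c := by
    intro j
    have := (measurePreserving_sub_right volume (v j)).setLIntegral_comp_preimage hU
      (f := fun h => f (v j + h)) (hf.comp (measurable_const_add _))
    simpa using this.symm
  have hdisj : Pairwise (Function.onFun Disjoint P) := by
    intro j j' hjj'
    refine Set.disjoint_left.2 fun c hc hc' => hjj' (funext fun i => ?_)
    have h1 := hc i (mem_univ i)
    have h2 := hc' i (mem_univ i)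
    simp only [Pi.sub_apply, mem_Ico, v, sub_nonneg, sub_lt_iff_lt_add'] at h1 h2
    rw [← Int.floor_eq_iff.2 ⟨h1.1, h1.2⟩, ← Int.floor_eq_iff.2 ⟨h2.1, h2.2⟩]
  have hae : (Icc (0 : ι → ℝ) 1 : Set (ι → ℝ)) =ᵐ[volume] U :=
    (Measure.univ_pi_Ico_ae_eq_Icc (f := (0 : ι → ℝ)) (g := 1)).symm
  calc _ = ∫⁻ h in U, ∑' j : ι → ℤ, f (v j + h) := setLIntegral_congr hae
    _ = ∑' j : ι → ℤ, ∫⁻ h in U, f (v j + h) :=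
        lintegral_tsum fun j => (hf.comp (measurable_const_add _)).aemeasurable
    _ = ∑' j : ι → ℤ, ∫⁻ c in P j, f c := by simp_rw [hterm]
    _ = ∫⁻ c in ⋃ j, P j, f c := (lintegral_iUnion hP hdisj _).symm
    _ ≤ _ := setLIntegral_le_lintegral _ _

/-- The relation between the parameters `(r, c)` of a cube and a point `(w, s)` of the half-space
lying near its boundary, where the three cases stand for the bottom, top and lateral faces. -/
def skeletonNhd (m : ℕ) (lam : ℝ) : Set ((ℝ × (Fin m → ℝ)) × (Euc m × ℝ)) :=
  {e | 0 < e.2.2 ∧ e.2.2 ≤ 4 * e.1.1 ∧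
    (∀ i, e.1.1 * e.1.2 i - e.2.2 ≤ e.2.1 i ∧ e.2.1 i ≤ e.1.1 * (e.1.2 i + 1) + e.2.2) ∧
    (e.1.1 / (lam - 1) ∈ Icc (e.2.2 / 2) e.2.2 ∨ lam * e.1.1 / (lam - 1) ∈ Icc (e.2.2 / 2) e.2.2 ∨
      ∃ i, |e.2.1 i - e.1.1 * e.1.2 i| ≤ e.2.2 ∨ |e.2.1 i - e.1.1 * (e.1.2 i + 1)| ≤ e.2.2)}

lemma measurableSet_skeletonNhd (m : ℕ) (lam : ℝ) : MeasurableSet (skeletonNhd m lam) := by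
  have hw : ∀ i, Continuous fun e : (ℝ × (Fin m → ℝ)) × (Euc m × ℝ) => e.2.1 i := by fun_prop
  have hs : Continuous fun e : (ℝ × (Fin m → ℝ)) × (Euc m × ℝ) => e.2.2 := by fun_prop
  have h1 : ∀ i, Continuous fun e : (ℝ × (Fin m → ℝ)) × (Euc m × ℝ) => e.1.1 * e.1.2 i := by
    fun_prop
  have h2 : ∀ i, Continuous fun e : (ℝ × (Fin m → ℝ)) × (Euc m × ℝ) => e.1.1 * (e.1.2 i + 1) := by
    fun_prop
  have h3 : Continuous fun e : (ℝ × (Fin m → ℝ)) × (Euc m × ℝ) => e.1.1 / (lam - 1) := by fun_prop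
  have h4 : Continuous fun e : (ℝ × (Fin m → ℝ)) × (Euc m × ℝ) => lam * e.1.1 / (lam - 1) := by
    fun_prop
  have h5 : Continuous fun e : (ℝ × (Fin m → ℝ)) × (Euc m × ℝ) => 4 * e.1.1 := by fun_prop
  have hle : ∀ {f g : (ℝ × (Fin m → ℝ)) × (Euc m × ℝ) → ℝ}, Continuous f → Continuous g →
      MeasurableSet {e | f e ≤ g e} := fun hf hg => measurableSet_le hf.measurable hg.measurable
  have hall : MeasurableSet {e : (ℝ × (Fin m → ℝ)) × (Euc m × ℝ) |
      ∀ i, e.1.1 * e.1.2 i - e.2.2 ≤ e.2.1 i ∧ e.2.1 i ≤ e.1.1 * (e.1.2 i + 1) + e.2.2} := by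
    rw [ofPred_forall]
    exact .iInter fun i => (hle ((h1 i).sub hs) (hw i)).inter (hle (hw i) ((h2 i).add hs))
  have hex : MeasurableSet {e : (ℝ × (Fin m → ℝ)) × (Euc m × ℝ) |
      ∃ i, |e.2.1 i - e.1.1 * e.1.2 i| ≤ e.2.2 ∨
        |e.2.1 i - e.1.1 * (e.1.2 i + 1)| ≤ e.2.2} := by
    rw [ofPred_exists]
    exact .iUnion fun i => (hle ((hw i).sub (h1 i)).abs hs).union
      (hle ((hw i).sub (h2 i)).abs hs)
  exact (measurableSet_lt measurable_const hs.measurable).inter ((hle hs h5).inter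
    (hall.inter (((hle (hs.div_const 2) h3).inter (hle h3 hs)).union
      (((hle (hs.div_const 2) h4).inter (hle h4 hs)).union hex))))

lemma frontier_cubeQ_cases {m : ℕ} {lam τ : ℝ} {k : ℤ} {c : Fin m → ℝ} {x : Euc m × ℝ}
    (hx : x ∈ frontier (cubeQ m lam τ k c)) :
    x ∈ cubeQ m lam τ k c ∧ (x.2 = τ * lam ^ (-k) / (lam - 1) ∨
      x.2 = τ * lam ^ (-(k - 1)) / (lam - 1) ∨
      ∃ i, x.1 i = τ * lam ^ (-k) * c i ∨ x.1 i = τ * lam ^ (-k) * (c i + 1)) := by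
  set r := τ * lam ^ (-k)
  have hcoord : ∀ i, Continuous fun y : Euc m => y i := by fun_prop
  have hcube : cube m r c = ⋂ i, (fun y : Euc m => y i) ⁻¹' Icc (r * c i) (r * (c i + 1)) := by
    ext; simp [cube]
  have hclosed : IsClosed (cubeQ m lam τ k c) := by
    refine IsClosed.prod ?_ isClosed_Icc
    rw [hcube]
    exact isClosed_iInter fun i => isClosed_Icc.preimage (hcoord i)
  have hxQ : x ∈ cubeQ m lam τ k c := hclosed.frontier_subset hx
  refine ⟨hxQ, ?_⟩
  by_contra! h
  obtain ⟨hb, ht, hi⟩ := h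
  refine hx.2 (mem_interior.2 ⟨(⋂ i, (fun y : Euc m => y i) ⁻¹' Ioo (r * c i) (r * (c i + 1))) ×ˢ
    Ioo (r / (lam - 1)) (τ * lam ^ (-(k - 1)) / (lam - 1)), ?_, ?_, ?_, ?_⟩)
  · refine prod_mono ?_ Ioo_subset_Icc_self
    change _ ⊆ cube m r c
    rw [hcube]
    exact iInter_mono fun i => preimage_mono Ioo_subset_Icc_self
  · exact (isOpen_iInter_of_finite fun i => isOpen_Ioo.preimage (hcoord i)).prod isOpen_Ioo
  · refine mem_iInter.2 fun i => ?_
    exact ⟨(hxQ.1 i).1.lt_of_ne' (hi i).1, (hxQ.1 i).2.lt_of_ne (hi i).2⟩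
  · exact ⟨hxQ.2.1.lt_of_ne' hb, hxQ.2.2.lt_of_ne ht⟩

lemma mem_skeletonNhd {m : ℕ} {lam τ : ℝ} (hlam : 2 ≤ lam) (hτ : 0 < τ) {k : ℤ} {c : Fin m → ℝ}
    {x : Euc m × ℝ} (hx : x ∈ frontier (cubeQ m lam τ k c)) :
    0 < x.2 ∧ ∀ p ∈ closedBall x.1 x.2 ×ˢ Icc x.2 (2 * x.2),
      ((τ * lam ^ (-k), c), p) ∈ skeletonNhd m lam := by
  obtain ⟨hxQ, hcase⟩ := frontier_cubeQ_cases hx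
  have hlam0 : 0 < lam := by linarith
  have hl1 : 0 < lam - 1 := by linarith
  have htop : τ * lam ^ (-(k - 1)) = lam * (τ * lam ^ (-k)) := by
    rw [show -(k - 1) = -k + 1 by ring, zpow_add_one₀ hlam0.ne']; ring
  rw [htop] at hcase
  obtain ⟨hx1, hx2, hx3⟩ := hxQ
  rw [htop] at hx3
  set r := τ * lam ^ (-k)
  have hr : 0 < r := mul_pos hτ (zpow_pos hlam0 _)
  have hx0 : 0 < x.2 := (div_pos hr hl1).trans_le hx2
  have hx2r : x.2 ≤ 2 * r := by
    refine hx3.trans ?_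
    rw [div_le_iff₀ hl1]
    nlinarith
  refine ⟨hx0, ?_⟩
  rintro ⟨w, s⟩ ⟨hw, hs1, hs2⟩
  simp only at hw hs1 hs2
  have hwi : ∀ i, |w i - x.1 i| ≤ x.2 := by
    intro i
    rw [mem_closedBall, dist_eq_norm] at hw
    exact (PiLp.norm_apply_le (w - x.1) i).trans hw
  refine ⟨hx0.trans_le hs1, by simp only; linarith, fun i => ?_, ?_⟩
  · have h1 := abs_le.1 (hwi i)
    have h2 := hx1 i
    constructor <;> simp only <;> linarith [h2.1, h2.2]
  · have hmem : x.2 ∈ Icc (s / 2) s := ⟨by linarith, hs1⟩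
    rcases hcase with h | h | ⟨i, h | h⟩
    · exact Or.inl (h ▸ hmem)
    · exact Or.inr (Or.inl (h ▸ hmem))
    · exact Or.inr (Or.inr ⟨i, Or.inl (h ▸ (hwi i).trans hs1)⟩)
    · exact Or.inr (Or.inr ⟨i, Or.inr (h ▸ (hwi i).trans hs1)⟩)

lemma volume_slab_le {m : ℕ} {T : Set (Fin m → ℝ)} {a b : Fin m → ℝ} (i : Fin m) {lo hi ε : ℝ}
    (hT : ∀ c ∈ T, c i ∈ Icc lo hi ∧ ∀ j, c j ∈ Icc (a j) (b j)) (hab : ∀ j, b j - a j ≤ 9)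
    (hε : hi - lo ≤ ε) : volume T ≤ ENNReal.ofReal (9 ^ m * ε) := by
  classical
  have hsub : T ⊆ univ.pi fun j => if j = i then Icc lo hi else Icc (a j) (b j) := by
    intro c hc j _
    rcases eq_or_ne j i with rfl | h
    · simpa using (hT c hc).1
    · simpa [h] using (hT c hc).2 j
  calc volume T ≤ _ := measure_mono hsub
    _ = ENNReal.ofReal (hi - lo) *
        ∏ j ∈ ({i}ᶜ : Finset (Fin m)), volume (if j = i then Icc lo hi else Icc (a j) (b j)) := by
      rw [volume_pi_pi, Fintype.prod_eq_mul_prod_compl i, if_pos rfl, Real.volume_Icc]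
    _ ≤ ENNReal.ofReal ε * ENNReal.ofReal 9 ^ m := by
      gcongr
      calc _ ≤ ENNReal.ofReal 9 ^ (({i}ᶜ : Finset (Fin m)).card) := by
            refine Finset.prod_le_pow_card _ _ _ fun j hj => ?_
            rw [if_neg (by simpa using hj), Real.volume_Icc]
            exact ENNReal.ofReal_le_ofReal (hab j)
        _ ≤ _ := pow_le_pow_right₀ (by simp) ((Finset.card_le_univ _).trans (by simp))
    _ = _ := by
      rw [← ENNReal.ofReal_pow (by norm_num), mul_comm, ← ENNReal.ofReal_mul (by positivity)]

lemma volume_box_le {m : ℕ} {T : Set (Fin m → ℝ)} {a b : Fin m → ℝ}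
    (hT : ∀ c ∈ T, ∀ j, c j ∈ Icc (a j) (b j)) (hab : ∀ j, b j - a j ≤ 9) :
    volume T ≤ ENNReal.ofReal (9 ^ m) := by
  calc volume T ≤ volume (Icc a b) :=
        measure_mono fun c hc => ⟨fun j => (hT c hc j).1, fun j => (hT c hc j).2⟩
    _ ≤ ENNReal.ofReal 9 ^ m := by
        rw [Real.volume_Icc_pi]
        refine (Finset.prod_le_pow_card _ _ _ fun j _ => ENNReal.ofReal_le_ofReal (hab j)).trans ?_
        simp
    _ = _ := (ENNReal.ofReal_pow (by norm_num) _).symm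

lemma volume_skeletonNhd_slice_le {m : ℕ} {lam : ℝ} (hlam : 2 ≤ lam) {r : ℝ} (hr : 0 < r)
    (p : Euc m × ℝ) :
    volume {c : Fin m → ℝ | ((r, c), p) ∈ skeletonNhd m lam} ≤
      (Icc ((lam - 1) * p.2 / 2) (2 * ((lam - 1) * p.2 / 2))).indicator
        (fun _ => ENNReal.ofReal (9 ^ m)) r +
      (Icc ((lam - 1) * p.2 / (2 * lam)) (2 * ((lam - 1) * p.2 / (2 * lam)))).indicator
        (fun _ => ENNReal.ofReal (9 ^ m)) r +
      (Ioi (p.2 / 5)).indicator (fun r => ENNReal.ofReal (4 * m * 9 ^ m * p.2 * r⁻¹)) r := by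
  obtain ⟨w, s⟩ := p
  simp only
  have hl0 : 0 < lam := by linarith
  have hl1 : 0 < lam - 1 := by linarith
  by_cases hs : 0 < s ∧ s ≤ 4 * r
  swap
  · rw [show {c : Fin m → ℝ | ((r, c), (w, s)) ∈ skeletonNhd m lam} = ∅ from
      eq_empty_of_forall_notMem fun c hc => hs ⟨hc.1, hc.2.1⟩, measure_empty]
    exact zero_le
  obtain ⟨hs0, hsr⟩ := hs
  set a : Fin m → ℝ := fun j => (w j - s) / r - 1
  set b : Fin m → ℝ := fun j => (w j + s) / r
  have hsr' : s / r ≤ 4 := (div_le_iff₀ hr).2 hsr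
  have hab : ∀ j, b j - a j ≤ 9 := by
    intro j
    have : b j - a j = 1 + 2 * (s / r) := by simp only [a, b]; ring
    linarith
  have hbox : ∀ c ∈ {c : Fin m → ℝ | ((r, c), (w, s)) ∈ skeletonNhd m lam},
      ∀ j, c j ∈ Icc (a j) (b j) := by
    rintro c ⟨-, -, hc, -⟩ j
    obtain ⟨h1, h2⟩ := hc j
    simp only at h1 h2
    simp only [a, b, mem_Icc, sub_le_iff_le_add, div_le_iff₀ hr, le_div_iff₀ hr]
    constructor <;> linarith
  by_cases h1 : r ∈ Icc ((lam - 1) * s / 2) (2 * ((lam - 1) * s / 2))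
  · rw [indicator_of_mem h1, add_assoc]
    exact (volume_box_le hbox hab).trans le_self_add
  by_cases h2 : r ∈ Icc ((lam - 1) * s / (2 * lam)) (2 * ((lam - 1) * s / (2 * lam)))
  · rw [indicator_of_mem h2]
    exact (volume_box_le hbox hab).trans (le_add_self.trans le_self_add)
  rw [indicator_of_mem (show r ∈ Ioi (s / 5) by rw [mem_Ioi]; linarith)]
  refine le_trans ?_ le_add_self
  have hsub : {c : Fin m → ℝ | ((r, c), (w, s)) ∈ skeletonNhd m lam} ⊆
      ⋃ i : Fin m, ({c | (∀ j, c j ∈ Icc (a j) (b j)) ∧ |w i - r * c i| ≤ s} ∪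
        {c | (∀ j, c j ∈ Icc (a j) (b j)) ∧ |w i - r * (c i + 1)| ≤ s}) := by
    intro c hc
    have hcb := hbox c hc
    obtain ⟨-, -, -, h | h | ⟨i, h | h⟩⟩ := hc
    · refine absurd ⟨?_, ?_⟩ h1
      · have := (le_div_iff₀ hl1).1 h.1
        simp only at this; linarith
      · have := (div_le_iff₀ hl1).1 h.2
        simp only at this; linarith
    · refine absurd ⟨?_, ?_⟩ h2
      · have := (le_div_iff₀ hl1).1 h.1
        simp only at this
        rw [div_le_iff₀ (by positivity)]; linarith
      · have := (div_le_iff₀ hl1).1 h.2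
        simp only at this
        rw [show 2 * ((lam - 1) * s / (2 * lam)) = (lam - 1) * s / lam by field_simp,
          le_div_iff₀ hl0]
        linarith
    · exact mem_iUnion.2 ⟨i, Or.inl ⟨hcb, h⟩⟩
    · exact mem_iUnion.2 ⟨i, Or.inr ⟨hcb, h⟩⟩
  have hface : ∀ i : Fin m, volume
      ({c : Fin m → ℝ | (∀ j, c j ∈ Icc (a j) (b j)) ∧ |w i - r * c i| ≤ s} ∪
        {c : Fin m → ℝ | (∀ j, c j ∈ Icc (a j) (b j)) ∧ |w i - r * (c i + 1)| ≤ s}) ≤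
      ENNReal.ofReal (4 * 9 ^ m * s * r⁻¹) := by
    intro i
    have hlow : volume {c : Fin m → ℝ | (∀ j, c j ∈ Icc (a j) (b j)) ∧ |w i - r * c i| ≤ s} ≤
        ENNReal.ofReal (9 ^ m * (2 * (s * r⁻¹))) := by
      refine volume_slab_le i (lo := (w i - s) / r) (hi := (w i + s) / r)
        (fun c hc => ⟨?_, hc.1⟩) hab (le_of_eq (by ring))
      have := abs_le.1 hc.2
      rw [mem_Icc, div_le_iff₀ hr, le_div_iff₀ hr]
      constructor <;> linarith
    have hup : volume
        {c : Fin m → ℝ | (∀ j, c j ∈ Icc (a j) (b j)) ∧ |w i - r * (c i + 1)| ≤ s} ≤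
        ENNReal.ofReal (9 ^ m * (2 * (s * r⁻¹))) := by
      refine volume_slab_le i (lo := (w i - s) / r - 1) (hi := (w i + s) / r - 1)
        (fun c hc => ⟨?_, hc.1⟩) hab (le_of_eq (by ring))
      have := abs_le.1 hc.2
      rw [mem_Icc, sub_le_iff_le_add, le_sub_iff_add_le, div_le_iff₀ hr, le_div_iff₀ hr]
      constructor <;> linarith
    refine (measure_union_le _ _).trans ((add_le_add hlow hup).trans (le_of_eq ?_))
    rw [← ENNReal.ofReal_add (by positivity) (by positivity)]
    congr 1; ring
  calc _ ≤ _ := measure_mono hsub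
    _ ≤ ∑ i : Fin m, ENNReal.ofReal (4 * 9 ^ m * s * r⁻¹) := by
      refine (measure_iUnion_fintype_le _ _).trans (Finset.sum_le_sum fun i _ => hface i)
    _ = _ := by
      rw [Finset.sum_const, Finset.card_univ, Fintype.card_fin, nsmul_eq_mul,
        ← ENNReal.ofReal_natCast, ← ENNReal.ofReal_mul (by positivity)]
      congr 1; ring

lemma lintegral_Icc_inv_le {a : ℝ} (ha : 0 < a) :
    ∫⁻ r in Icc a (2 * a), ENNReal.ofReal r⁻¹ ≤ 1 := by
  calc ∫⁻ r in Icc a (2 * a), ENNReal.ofReal r⁻¹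
      ≤ ∫⁻ _ in Icc a (2 * a), ENNReal.ofReal a⁻¹ :=
        setLIntegral_mono' measurableSet_Icc fun r hr =>
          ENNReal.ofReal_le_ofReal (inv_anti₀ ha hr.1)
    _ = 1 := by
        rw [setLIntegral_const, Real.volume_Icc, ← ENNReal.ofReal_mul (by positivity),
          show a⁻¹ * (2 * a - a) = 1 by field_simp; norm_num, ENNReal.ofReal_one]

lemma lintegral_volume_skeletonNhd_slice_le {m : ℕ} {lam : ℝ} (hlam : 2 ≤ lam)
    {p : Euc m × ℝ} (hp : 0 < p.2) :
    ∫⁻ r in Ioi (0 : ℝ), volume {c : Fin m → ℝ | ((r, c), p) ∈ skeletonNhd m lam} *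
      ENNReal.ofReal r⁻¹ ≤ ENNReal.ofReal (9 ^ m * (2 + 20 * m)) := by
  have hl0 : 0 < lam := by linarith
  have hl1 : 0 < lam - 1 := by linarith
  set s := p.2
  have hIcc : ∀ a : ℝ, 0 < a → ∫⁻ r, (Icc a (2 * a)).indicator
      (fun _ => ENNReal.ofReal (9 ^ m)) r * ENNReal.ofReal r⁻¹ ≤ ENNReal.ofReal (9 ^ m) := by
    intro a ha
    rw [lintegral_congr fun r => (indicator_mul_left _ _ fun r => ENNReal.ofReal r⁻¹).symm,
      lintegral_indicator measurableSet_Icc, lintegral_const_mul' _ _ ENNReal.ofReal_ne_top]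
    exact mul_le_of_le_one_right' (lintegral_Icc_inv_le ha)
  have hIoi : ∫⁻ r, (Ioi (s / 5)).indicator
      (fun r => ENNReal.ofReal (4 * m * 9 ^ m * s * r⁻¹)) r * ENNReal.ofReal r⁻¹ =
      ENNReal.ofReal (20 * m * 9 ^ m) := by
    rw [lintegral_congr fun r => (indicator_mul_left _ _ fun r => ENNReal.ofReal r⁻¹).symm,
      lintegral_indicator measurableSet_Ioi]
    calc _ = ∫⁻ r in Ioi (s / 5), ENNReal.ofReal (4 * m * 9 ^ m * s) *
          ENNReal.ofReal (r⁻¹ ^ (1 + 1)) := by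
          refine setLIntegral_congr_fun measurableSet_Ioi fun r hr => ?_
          have hr0 : 0 < r := lt_trans (by positivity) hr
          rw [← ENNReal.ofReal_mul (by positivity), ← ENNReal.ofReal_mul (by positivity)]
          congr 1; ring
      _ = _ := by
          rw [lintegral_const_mul' _ _ ENNReal.ofReal_ne_top,
            lintegral_Ioi_inv_pow (by positivity) le_rfl, ← ENNReal.ofReal_mul (by positivity)]
          congr 1
          field_simp
          push_cast; ring
  have hmI : ∀ a b : ℝ, Measurable fun r : ℝ => (Icc a b).indicator
      (fun _ => ENNReal.ofReal (9 ^ m)) r * ENNReal.ofReal r⁻¹ := fun a b =>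
    (measurable_const.indicator measurableSet_Icc).mul (by fun_prop)
  have hmS : Measurable fun r : ℝ => (Ioi (s / 5)).indicator
      (fun r => ENNReal.ofReal (4 * m * 9 ^ m * s * r⁻¹)) r * ENNReal.ofReal r⁻¹ :=
    (Measurable.indicator (by fun_prop) measurableSet_Ioi).mul (by fun_prop)
  calc _ ≤ ∫⁻ r, ((Icc ((lam - 1) * s / 2) (2 * ((lam - 1) * s / 2))).indicator
          (fun _ => ENNReal.ofReal (9 ^ m)) r * ENNReal.ofReal r⁻¹ +
        (Icc ((lam - 1) * s / (2 * lam)) (2 * ((lam - 1) * s / (2 * lam)))).indicator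
          (fun _ => ENNReal.ofReal (9 ^ m)) r * ENNReal.ofReal r⁻¹ +
        (Ioi (s / 5)).indicator (fun r => ENNReal.ofReal (4 * m * 9 ^ m * s * r⁻¹)) r *
          ENNReal.ofReal r⁻¹) := by
        refine (setLIntegral_mono' measurableSet_Ioi fun r hr => ?_).trans
          (setLIntegral_le_lintegral _ _)
        rw [← add_mul, ← add_mul]
        gcongr
        exact volume_skeletonNhd_slice_le hlam hr p
    _ ≤ ENNReal.ofReal (9 ^ m) + ENNReal.ofReal (9 ^ m) + ENNReal.ofReal (20 * m * 9 ^ m) := by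
        rw [lintegral_add_right _ hmS, lintegral_add_right _ (hmI _ _), hIoi]
        gcongr
        · exact hIcc _ (by positivity)
        · exact hIcc _ (by positivity)
    _ = _ := by
        rw [← ENNReal.ofReal_add (by positivity) (by positivity),
          ← ENNReal.ofReal_add (by positivity) (by positivity)]
        congr 1; ring

lemma lintegral_skeletonNhd_le {m : ℕ} {lam : ℝ} (hlam : 2 ≤ lam) {g : Euc m × ℝ → ℝ≥0∞}
    (hg : Measurable g) :
    ∫⁻ r in Ioi (0 : ℝ), (∫⁻ c, ∫⁻ p, (skeletonNhd m lam).indicator (fun e => g e.2) ((r, c), p)) *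
      ENNReal.ofReal r⁻¹ ≤
    ENNReal.ofReal (9 ^ m * (2 + 20 * m)) * ∫⁻ p in {p : Euc m × ℝ | 0 < p.2}, g p := by
  have hS := measurableSet_skeletonNhd m lam
  have hpos : MeasurableSet {p : Euc m × ℝ | 0 < p.2} :=
    measurableSet_lt measurable_const measurable_snd
  have hG : Measurable ((skeletonNhd m lam).indicator fun e => g e.2) :=
    (hg.comp measurable_snd).indicator hS
  set v : ℝ → Euc m × ℝ → ℝ≥0∞ := fun r p =>
    volume {c : Fin m → ℝ | ((r, c), p) ∈ skeletonNhd m lam}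
  have hv : Measurable fun q : ℝ × (Euc m × ℝ) => v q.1 q.2 :=
    measurable_measure_prodMk_left (ν := (volume : Measure (Fin m → ℝ)))
      (s := (fun t : (ℝ × (Euc m × ℝ)) × (Fin m → ℝ) => ((t.1.1, t.2), t.1.2)) ⁻¹' skeletonNhd m lam)
      (hS.preimage (by fun_prop))
  have hslice : ∀ r, ∫⁻ c, ∫⁻ p, (skeletonNhd m lam).indicator (fun e => g e.2) ((r, c), p) =
      ∫⁻ p, g p * v r p := by
    intro r
    rw [lintegral_lintegral_swap (Measurable.aemeasurable
      (f := fun q : (Fin m → ℝ) × (Euc m × ℝ) =>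
        (skeletonNhd m lam).indicator (fun e => g e.2) ((r, q.1), q.2)) (hG.comp (by fun_prop)))]
    refine lintegral_congr fun p => ?_
    have hT : MeasurableSet {c : Fin m → ℝ | ((r, c), p) ∈ skeletonNhd m lam} :=
      hS.preimage (f := fun c : Fin m → ℝ => ((r, c), p)) (by fun_prop)
    rw [← setLIntegral_const, ← lintegral_indicator hT]
    rfl
  simp_rw [hslice]
  calc _ = ∫⁻ r in Ioi (0 : ℝ), ∫⁻ p, g p * (v r p * ENNReal.ofReal r⁻¹) := by
        refine lintegral_congr fun r => ?_
        rw [← lintegral_mul_const' _ _ ENNReal.ofReal_ne_top]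
        simp_rw [mul_assoc]
    _ = ∫⁻ p, ∫⁻ r in Ioi (0 : ℝ), g p * (v r p * ENNReal.ofReal r⁻¹) :=
        lintegral_lintegral_swap (Measurable.aemeasurable
          ((hg.comp measurable_snd).mul (hv.mul (by fun_prop))))
    _ = ∫⁻ p, g p * ∫⁻ r in Ioi (0 : ℝ), v r p * ENNReal.ofReal r⁻¹ := by
        refine lintegral_congr fun p => lintegral_const_mul _ ?_
        exact (hv.comp (by fun_prop : Measurable fun r : ℝ => (r, p))).mul (by fun_prop)
    _ ≤ ∫⁻ p, ENNReal.ofReal (9 ^ m * (2 + 20 * m)) *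
          {p : Euc m × ℝ | 0 < p.2}.indicator g p := by
        refine lintegral_mono fun p => ?_
        rw [mul_comm]
        by_cases hp : 0 < p.2
        · rw [indicator_of_mem (show p ∈ {p : Euc m × ℝ | 0 < p.2} from hp)]
          gcongr
          exact lintegral_volume_skeletonNhd_slice_le hlam hp
        · have h0 : ∀ r, v r p = 0 := fun r => by
            simp only [v]
            rw [show {c : Fin m → ℝ | ((r, c), p) ∈ skeletonNhd m lam} = ∅ from
              eq_empty_of_forall_notMem fun c hc => hp hc.1, measure_empty]
          simp [h0]
    _ = _ := by
        rw [lintegral_const_mul' _ _ ENNReal.ofReal_ne_top, lintegral_indicator hpos]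

lemma exists_norm_fderiv_avgExt_le {m : ℕ} {φ : Euc m → ℝ} (hφ : ContDiff ℝ 1 φ)
    (hφsupp : tsupport φ ⊆ ball (0 : Euc m) 1) :
    ∃ K : ℝ, 0 ≤ K ∧ ∀ {ν : ℕ} {u : Euc m → Euc ν}, Measurable u → (∃ B, ∀ x, ‖u x‖ ≤ B) →
      ∀ {x : Euc m × ℝ}, 0 < x.2 → ∀ c, ‖fderiv ℝ (avgExt φ u) x‖ ≤
        K * x.2⁻¹ ^ (m + 1) * ∫ y in closedBall x.1 (2 * x.2), ‖u y - c‖ := by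
  have hcs : HasCompactSupport φ := (isCompact_closedBall (0 : Euc m) 1).of_isClosed_subset
    (isClosed_tsupport φ) (hφsupp.trans ball_subset_closedBall)
  obtain ⟨M, hM⟩ := hcs.exists_bound_of_continuous hφ.continuous
  obtain ⟨L, hL⟩ := hφ.lipschitzWith_of_hasCompactSupport hcs one_ne_zero
  have hM0 : 0 ≤ M := (norm_nonneg _).trans (hM 0)
  refine ⟨2 ^ m * m * M + 6 * L, by positivity, fun hu ⟨B, hB⟩ _ hx c => ?_⟩
  refine norm_fderiv_avgExt_le (hφ.continuous.integrable_of_hasCompactSupport hcs) hM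
    (fun a b => ?_) L.2 (fun a ha => ?_) hu hB c hx
  · simpa [dist_eq_norm] using hL.dist_le_mul a b
  · exact image_eq_zero_of_notMem_tsupport fun h => by
      have := hφsupp h
      rw [mem_ball_zero_iff] at this
      linarith

lemma exists_fderiv_avgExt_pow_le_lintegral_oscDensity {m : ℕ} {φ : Euc m → ℝ}
    (hφ : ContDiff ℝ 1 φ) (hφsupp : tsupport φ ⊆ ball (0 : Euc m) 1) :
    ∃ C : ℝ, 0 ≤ C ∧ ∀ {ν : ℕ} {u : Euc m → Euc ν}, Measurable u → (∃ B, ∀ x, ‖u x‖ ≤ B) →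
      ∀ {x : Euc m × ℝ}, 0 < x.2 →
        ENNReal.ofReal (x.2 ^ (m + 1) * ‖fderiv ℝ (avgExt φ u) x‖ ^ (m + 1)) ≤
        ENNReal.ofReal C * ∫⁻ p in closedBall x.1 x.2 ×ˢ Icc x.2 (2 * x.2), oscDensity u p := by
  obtain ⟨K, hK, hD⟩ := exists_norm_fderiv_avgExt_le hφ hφsupp
  have hω := volume_real_unit_ball_pos m
  set ω := volume.real (ball (0 : Euc m) 1)
  refine ⟨K ^ (m + 1) * (2 ^ m * ω) ^ m / (2 ^ m * ω) * (2 ^ (3 * m + 1) / ω), by positivity,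
    fun {ν u} hu hbdd {x} hx => ?_⟩
  obtain ⟨B, hB⟩ := hbdd
  refine (ofReal_fderiv_avgExt_pow_le hu hB hK hx (hD hu ⟨B, hB⟩ hx)).trans ?_
  refine le_trans (le_of_eq ?_) (mul_le_mul_right
    (ofReal_mul_lintegral_le_lintegral_oscDensity u hx) _)
  rw [← mul_assoc, ← ENNReal.ofReal_mul (by positivity)]
  congr 2
  simp only [ω] at *
  field_simp

lemma lintegral_skeleton_sum_le {m : ℕ} {lam : ℝ} (hlam : 2 ≤ lam) {g : Euc m × ℝ → ℝ≥0∞}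
    (hg : Measurable g) {f : Euc m × ℝ → ℝ≥0∞} (hfg : ∀ x, 0 < x.2 →
      f x ≤ ∫⁻ p in closedBall x.1 x.2 ×ˢ Icc x.2 (2 * x.2), g p) :
    ∫⁻ τ in Ioc (1 : ℝ) lam, (∑' k : ℤ, ∫⁻ h in Icc (0 : Fin m → ℝ) 1, ∑' j : Fin m → ℤ,
      ⨆ x ∈ frontier (cubeQ m lam τ k (fun i => (j i : ℝ) + h i)), f x) * ENNReal.ofReal τ⁻¹ ≤
    ENNReal.ofReal (9 ^ m * (2 + 20 * m)) * ∫⁻ p in {p : Euc m × ℝ | 0 < p.2}, g p := by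
  have hS := measurableSet_skeletonNhd m lam
  have hG : Measurable ((skeletonNhd m lam).indicator fun e => g e.2) :=
    (hg.comp measurable_snd).indicator hS
  set D : ℝ × (Fin m → ℝ) → ℝ≥0∞ := fun q =>
    ∫⁻ p, (skeletonNhd m lam).indicator (fun e => g e.2) (q, p) with hDdef
  have hD : Measurable D := hG.lintegral_prod_right'
  have hD1 : Measurable fun r => ∫⁻ c, D (r, c) := hD.lintegral_prod_right'
  have hsup : ∀ {τ : ℝ}, 0 < τ → ∀ (k : ℤ) (c : Fin m → ℝ),
      ⨆ x ∈ frontier (cubeQ m lam τ k c), f x ≤ D (τ * lam ^ (-k), c) := by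
    intro τ hτ k c
    refine iSup₂_le fun x hx => ?_
    obtain ⟨hx0, hsub⟩ := mem_skeletonNhd hlam hτ hx
    refine (hfg x hx0).trans ?_
    have hN : MeasurableSet (closedBall x.1 x.2 ×ˢ Icc x.2 (2 * x.2)) :=
      measurableSet_closedBall.prod measurableSet_Icc
    rw [← lintegral_indicator hN]
    refine lintegral_mono fun p => ?_
    by_cases hp : p ∈ closedBall x.1 x.2 ×ˢ Icc x.2 (2 * x.2)
    · rw [indicator_of_mem hp, indicator_of_mem (hsub p hp)]
    · rw [indicator_of_notMem hp]
      exact zero_le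
  calc _ ≤ ∫⁻ τ in Ioc (1 : ℝ) lam, ∑' k : ℤ,
          (∫⁻ c, D (τ * lam ^ (-k), c)) * ENNReal.ofReal τ⁻¹ := by
        refine setLIntegral_mono' measurableSet_Ioc fun τ hτ => ?_
        rw [ENNReal.tsum_mul_right]
        refine mul_le_mul_left (ENNReal.tsum_le_tsum fun k => ?_) _
        refine le_trans (lintegral_mono (g := fun h : Fin m → ℝ => ∑' j : Fin m → ℤ,
          D (τ * lam ^ (-k), fun i => (j i : ℝ) + h i)) fun h => ENNReal.tsum_le_tsum fun j =>
            hsup (zero_lt_one.trans hτ.1) k _) ?_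
        exact lintegral_Icc_tsum_intCast_add_le
          (hD.comp (by fun_prop : Measurable fun c : Fin m → ℝ => (τ * lam ^ (-k), c)))
    _ = ∑' k : ℤ, ∫⁻ τ in Ioc (1 : ℝ) lam,
          (∫⁻ c, D (τ * lam ^ (-k), c)) * ENNReal.ofReal τ⁻¹ :=
        lintegral_tsum fun k => ((hD1.comp
          (by fun_prop : Measurable fun τ : ℝ => τ * lam ^ (-k))).mul (by fun_prop)).aemeasurable
    _ ≤ _ := tsum_lintegral_Ioc_zpow_le (f := fun r => ∫⁻ c, D (r, c)) (by linarith)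
    _ ≤ _ := lintegral_skeletonNhd_le hlam hg

/-- Proposition 3.2: average uniform Sobolev bound on the skeleton. -/
theorem average_sobolev_bound_skeleton (m : ℕ) (hm : 1 ≤ m)
    (φ : Euc m → ℝ) (hφ : ContDiff ℝ (⊤ : ℕ∞) φ)
    (hφsupp : tsupport φ ⊆ ball (0 : Euc m) 1) (hφint : ∫ z, φ z = 1) :
    ∃ C : ℝ, 0 < C ∧
      ∀ (ν : ℕ), 1 ≤ ν →
      ∀ (lam : ℝ), 2 ≤ lam →
      ∀ (u : Euc m → Euc ν), Measurable u → (∃ M : ℝ, ∀ x, ‖u x‖ ≤ M) →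
      (∫⁻ τ in Ioc (1 : ℝ) lam,
        (∑' k : ℤ, ∫⁻ h in Icc (0 : Fin m → ℝ) 1,
          ∑' j : Fin m → ℤ,
            ⨆ x ∈ frontier (cubeQ m lam τ k (fun i => (j i : ℝ) + h i)),
              ENNReal.ofReal (x.2 ^ (m + 1) * ‖fderiv ℝ (avgExt φ u) x‖ ^ (m + 1)))
          * ENNReal.ofReal τ⁻¹)
      ≤ ENNReal.ofReal C *
        ∫⁻ y, ∫⁻ z, ENNReal.ofReal (dist (u y) (u z) ^ (m + 1)) /
          ENNReal.ofReal (dist y z ^ (2 * m)) := by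
  obtain ⟨C, hC, hbound⟩ := exists_fderiv_avgExt_pow_le_lintegral_oscDensity
    (hφ.of_le (by exact_mod_cast le_top)) hφsupp
  set A : ℝ := 3 ^ m * volume.real (ball (0 : Euc m) 1) * 7 ^ (2 * m)
  have hA : 0 ≤ A := by positivity
  refine ⟨9 ^ m * (2 + 20 * m) * (C * A) + 1, by positivity, fun ν _ lam hlam u hu hbdd => ?_⟩
  refine (lintegral_skeleton_sum_le hlam ((measurable_oscDensity hu).const_mul (ENNReal.ofReal C))
    fun x hx => ?_).trans ?_
  · rw [lintegral_const_mul' _ _ ENNReal.ofReal_ne_top]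
    exact hbound hu hbdd hx
  · rw [lintegral_const_mul' _ _ ENNReal.ofReal_ne_top]
    calc _ ≤ ENNReal.ofReal (9 ^ m * (2 + 20 * m)) * (ENNReal.ofReal C * (ENNReal.ofReal A *
          ∫⁻ y, ∫⁻ z, ENNReal.ofReal (dist (u y) (u z) ^ (m + 1)) /
            ENNReal.ofReal (dist y z ^ (2 * m)))) := by
          gcongr
          exact lintegral_oscDensity_le hm hu
      _ ≤ _ := by
          rw [← mul_assoc (ENNReal.ofReal C), ← ENNReal.ofReal_mul hC, ← mul_assoc,
            ← ENNReal.ofReal_mul (by positivity)]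
          gcongr
          linarith
end
end

section
/- Let m ≥ 1 be an integer and ρ ∈ (0,∞). For every Borel measurable function g : S^m_ρ → [0,∞] and every t ∈ (0,∞), one has L^{m+1}({ x ∈ B^{m+1}_ρ \ {0} : (ρ/|x|)·g(ρx/|x|) > t }) ≤ ρ/((m+1)·t^{m+1}) · ∫_{S^m_ρ} g^{m+1} dH^m. -/
open MeasureTheory Metric Set
open scoped ENNReal Topology

noncomputable section

section

open scoped Pointwise RealInnerProductSpace

variable {E : Type*} [NormedAddCommGroup E] [InnerProductSpace ℝ E] [FiniteDimensional ℝ E]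
  [MeasurableSpace E] [BorelSpace E]

theorem OrthonormalBasis.volume_le_prod_ediam_image_inner {ι : Type*} [Fintype ι]
    (b : OrthonormalBasis ι ℝ E) (s : Set E) :
    volume s ≤ ∏ i, ediam ((fun x => ⟪b i, x⟫) '' s) := by
  have hf : MeasurePreserving ((MeasurableEquiv.toLp 2 (ι → ℝ)).symm ∘ b.repr) :=
    (EuclideanSpace.volume_preserving_symm_measurableEquiv_toLp ι).comp b.measurePreserving_repr
  have hinj : Function.Injective ((MeasurableEquiv.toLp 2 (ι → ℝ)).symm ∘ b.repr) :=
    (MeasurableEquiv.injective _).comp b.repr.injective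
  have hemb : MeasurableEmbedding ((MeasurableEquiv.toLp 2 (ι → ℝ)).symm ∘ b.repr) :=
    (MeasurableEquiv.measurableEmbedding _).comp
      b.repr.toHomeomorph.measurableEmbedding
  have h := hf.measure_preimage_emb hemb (((MeasurableEquiv.toLp 2 (ι → ℝ)).symm ∘ b.repr) '' s)
  rw [hinj.preimage_image] at h
  rw [h]
  refine (Real.volume_pi_le_prod_diam _).trans_eq (Finset.prod_congr rfl fun i _ => ?_)
  rw [image_image]
  congr 2
  ext x
  simp [b.repr_apply_apply]

theorem one_sub_pow_succ_ge {q : ℝ} (hq : 0 ≤ q) (hq1 : q ≤ 1) (n : ℕ) :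
    (n + 1) * (q ^ n * (1 - q)) ≤ 1 - q ^ (n + 1) := by
  induction n with
  | zero => simp
  | succ n ih =>
    have h1 : q ^ (n + 1) ≤ 1 := pow_le_one₀ hq hq1
    have h2 := mul_le_mul_of_nonneg_left ih hq
    have h3 := mul_le_mul_of_nonneg_right h1 (sub_nonneg.2 hq1)
    push_cast
    rw [pow_succ q (n + 1)]
    rw [pow_succ q n] at *
    nlinarith

theorem volume_Ico_smul_le {m : ℕ} (hE : Module.finrank ℝ E = m + 1) {h δ : ℝ} (h0 : 0 < h)
    (h1 : h < 1) (δ0 : 0 ≤ δ) (hδ : δ ≤ h) {A : Set E} (hA : A ⊆ sphere 0 1)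
    (hAδ : ∀ x ∈ A, ∀ y ∈ A, dist x y ≤ δ) :
    volume (Ico (1 - h) 1 • A) ≤ ENNReal.ofReal (h * (1 + h) * ((1 + h) * δ) ^ m) := by
  obtain rfl | ⟨a, ha⟩ := A.eq_empty_or_nonempty
  · simp
  have hnorm : ∀ x ∈ A, ‖x‖ = 1 := fun x hx => by simpa using hA hx
  obtain ⟨b, hb⟩ : ∃ b : OrthonormalBasis (Fin (m + 1)) ℝ E, b 0 = a := by
    obtain ⟨b, hb⟩ := Orthonormal.exists_orthonormalBasis_extension_of_card_eq (𝕜 := ℝ)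
      (ι := Fin (m + 1)) (by simp [hE]) (v := fun _ => a) (s := {0})
      ⟨fun i => by simpa using hnorm a ha, fun i j hij => (hij (Subsingleton.elim i j)).elim⟩
    exact ⟨b, hb 0 rfl⟩
  have hcoord : ∀ i, i ≠ 0 → ∀ x ∈ A, |⟪b i, x⟫| ≤ δ := by
    intro i hi x hx
    have h2 : ⟪b i, x⟫ = ⟪b i, x - a⟫ := by
      rw [inner_sub_right, ← hb, b.inner_eq_zero hi, sub_zero]
    rw [h2]
    calc |⟪b i, x - a⟫| ≤ ‖b i‖ * ‖x - a‖ := abs_real_inner_le_norm _ _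
      _ ≤ δ := by rw [b.norm_eq_one, one_mul, ← dist_eq_norm]; exact hAδ x hx a ha
  have hrad : ∀ x ∈ A, 1 - h ^ 2 ≤ ⟪a, x⟫ ∧ ⟪a, x⟫ ≤ 1 := by
    intro x hx
    have h2 := norm_sub_sq_real a x
    have h3 : ‖a - x‖ ≤ h := by rw [← dist_eq_norm]; exact (hAδ a ha x hx).trans hδ
    rw [hnorm a ha, hnorm x hx] at h2
    constructor <;> nlinarith [norm_nonneg (a - x)]
  refine (b.volume_le_prod_ediam_image_inner _).trans ?_
  rw [Fin.prod_univ_succ, ENNReal.ofReal_mul (by positivity), ENNReal.ofReal_pow (by positivity)]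
  gcongr
  · apply ediam_le_of_forall_dist_le
    rintro _ ⟨_, ⟨r, hr, x, hx, rfl⟩, rfl⟩ _ ⟨_, ⟨s, hs, y, hy, rfl⟩, rfl⟩
    have key : ∀ r ∈ Ico (1 - h) 1, ∀ x ∈ A, r * ⟪a, x⟫ ≤ 1 ∧
        1 - h * (1 + h) ≤ r * ⟪a, x⟫ := by
      intro r hr x hx
      obtain ⟨hl, hu⟩ := hrad x hx
      have hr1 := hr.1
      have hr2 := hr.2
      have : 0 ≤ ⟪a, x⟫ := by nlinarith
      constructor
      · nlinarith
      · nlinarith [mul_nonneg (sub_nonneg.2 hr1) this,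
          mul_nonneg (sub_nonneg.2 h1.le) (sub_nonneg.2 hl), pow_pos h0 3]
    obtain ⟨k1, k2⟩ := key r hr x hx
    obtain ⟨k3, k4⟩ := key s hs y hy
    simp only [hb, real_inner_smul_right, Real.dist_eq]
    rw [abs_le]
    constructor <;> linarith
  · refine (Finset.prod_le_pow_card _ _ (ENNReal.ofReal ((1 + h) * δ)) fun i _ => ?_).trans_eq
      (by simp)
    apply ediam_le_of_forall_dist_le
    rintro _ ⟨_, ⟨r, hr, x, hx, rfl⟩, rfl⟩ _ ⟨_, ⟨s, hs, y, hy, rfl⟩, rfl⟩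
    simp only [real_inner_smul_right, Real.dist_eq]
    have e : r * ⟪b i.succ, x⟫ - s * ⟪b i.succ, y⟫
        = r * ⟪b i.succ, x - y⟫ + (r - s) * ⟪b i.succ, y⟫ := by
      rw [inner_sub_right]; ring
    have hxy : |⟪b i.succ, x - y⟫| ≤ δ := by
      calc |⟪b i.succ, x - y⟫| ≤ ‖b i.succ‖ * ‖x - y‖ := abs_real_inner_le_norm _ _
        _ ≤ δ := by rw [b.norm_eq_one, one_mul, ← dist_eq_norm]; exact hAδ x hx y hy
    have hr0 : |r| ≤ 1 := abs_le.2 ⟨by linarith [hr.1], hr.2.le⟩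
    have hrs : |r - s| ≤ h := abs_le.2 ⟨by linarith [hr.1, hs.2], by linarith [hr.2, hs.1]⟩
    rw [e]
    calc _ ≤ |r| * |⟪b i.succ, x - y⟫| + |r - s| * |⟪b i.succ, y⟫| := by
          rw [← abs_mul, ← abs_mul]; exact abs_add_le _ _
      _ ≤ 1 * δ + h * δ := by
          gcongr
          exact hcoord _ (Fin.succ_ne_zero i) y hy
      _ = (1 + h) * δ := by ring

theorem toSphere_mul_le_volume_Ico_smul {m : ℕ} (hE : Module.finrank ℝ E = m + 1) {h : ℝ}
    (h0 : 0 < h) (h1 : h < 1) {A : Set (sphere (0 : E) 1)} (hA : MeasurableSet A) :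
    ENNReal.ofReal ((1 - h) ^ m * h) * (volume : Measure E).toSphere A ≤
      volume (Ico (1 - h) 1 • ((↑) '' A : Set E)) := by
  have hq : 0 < 1 - h := by linarith
  rw [Measure.toSphere_apply' _ hA, hE]
  set B : Set E := (↑) '' A
  set V := volume (Ioo (0 : ℝ) 1 • B)
  have hV : V ≠ ∞ := by
    refine ((measure_mono ?_).trans_lt
      (measure_ball_lt_top (μ := volume) (x := (0 : E)) (r := 1))).ne
    rintro _ ⟨r, hr, _, ⟨x, hx, rfl⟩, rfl⟩
    simpa [norm_smul, abs_of_pos hr.1] using hr.2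
  have hsplit : V ≤ ENNReal.ofReal ((1 - h) ^ (m + 1)) * V + volume (Ico (1 - h) 1 • B) := by
    have : Ioo (0 : ℝ) 1 • B ⊆ ((1 - h) • (Ioo (0 : ℝ) 1 • B)) ∪ Ico (1 - h) 1 • B := by
      rw [← smul_assoc, LinearOrderedField.smul_Ioo hq, ← union_smul]
      refine smul_subset_smul_right fun r hr => ?_
      rcases lt_or_ge r (1 - h) with hl | hl
      · left; simpa using ⟨hr.1, hl⟩
      · right; exact ⟨hl, hr.2⟩
    refine (measure_mono this).trans ((measure_union_le _ _).trans_eq ?_)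
    rw [Measure.addHaar_smul_of_nonneg _ hq.le, hE]
  calc ENNReal.ofReal ((1 - h) ^ m * h) * ((m + 1 : ℕ) * V)
      = ENNReal.ofReal ((m + 1) * ((1 - h) ^ m * (1 - (1 - h)))) * V := by
        rw [ENNReal.ofReal_mul (by positivity : (0 : ℝ) ≤ m + 1)]
        rw [show (m : ℝ) + 1 = ((m + 1 : ℕ) : ℝ) by push_cast; ring, ENNReal.ofReal_natCast,
          sub_sub_cancel]
        ring
    _ ≤ ENNReal.ofReal (1 - (1 - h) ^ (m + 1)) * V := by
        gcongr
        exact one_sub_pow_succ_ge hq.le (by linarith) m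
    _ = V - ENNReal.ofReal ((1 - h) ^ (m + 1)) * V := by
        rw [ENNReal.ofReal_sub _ (by positivity), ENNReal.sub_mul fun _ _ => hV]
        simp
    _ ≤ _ := tsub_le_iff_left.2 hsplit

/-- The Hausdorff measure here is not normalized: on a Euclidean space of dimension `m` it exceeds
Lebesgue measure by the factor `2 ^ m / volume (ball 0 1)`, hence only an inequality. -/
theorem toSphere_le_hausdorffMeasure {m : ℕ} (hE : Module.finrank ℝ E = m + 1) :
    (volume : Measure E).toSphere ≤ μH[(m : ℝ)] := by
  have key : ∀ h ∈ Ioo (0 : ℝ) 1, ENNReal.ofReal ((1 - h) ^ m / (1 + h) ^ (m + 1)) •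
      (volume : Measure E).toSphere ≤ μH[(m : ℝ)] := by
    rintro h ⟨h0, h1⟩
    have hq : 0 < 1 - h := by linarith
    refine Measure.le_hausdorffMeasure _ _ (ENNReal.ofReal h) (by simpa) fun s hs => ?_
    have hfin : ediam s ≠ ∞ := (hs.trans_lt ENNReal.ofReal_lt_top).ne
    have hdiam : diam (closure s) ≤ h := by
      rw [diam_closure]; exact ENNReal.toReal_le_of_le_ofReal h0.le hs
    have H := (toSphere_mul_le_volume_Ico_smul hE h0 h1
      (isClosed_closure (s := s)).measurableSet).trans
      (volume_Ico_smul_le hE h0 h1 diam_nonneg hdiam (by rintro _ ⟨x, -, rfl⟩; exact x.2) (by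
        rintro _ ⟨x, hx, rfl⟩ _ ⟨y, hy, rfl⟩
        exact dist_le_diam_of_mem' (by rwa [ediam_closure]) hx hy))
    rw [ENNReal.rpow_natCast, Measure.smul_apply, smul_eq_mul]
    calc _ ≤ ENNReal.ofReal ((1 - h) ^ m / (1 + h) ^ (m + 1)) *
          (volume : Measure E).toSphere (closure s) := by gcongr; exact subset_closure
      _ = ENNReal.ofReal (1 / (h * (1 + h) ^ (m + 1))) * (ENNReal.ofReal ((1 - h) ^ m * h) *
          (volume : Measure E).toSphere (closure s)) := by
        rw [← mul_assoc, ← ENNReal.ofReal_mul (by positivity)]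
        congr 2
        field_simp
      _ ≤ ENNReal.ofReal (1 / (h * (1 + h) ^ (m + 1))) *
          ENNReal.ofReal (h * (1 + h) * ((1 + h) * diam (closure s)) ^ m) := by gcongr
      _ = ENNReal.ofReal (diam s ^ m) := by
        rw [← ENNReal.ofReal_mul (by positivity), diam_closure]
        congr 1
        rw [mul_pow, pow_succ]
        field_simp
      _ = ediam s ^ m := by
        rw [ENNReal.ofReal_pow diam_nonneg, diam, ENNReal.ofReal_toReal hfin]
  refine Measure.le_iff'.2 fun s => ?_
  have hcont : ContinuousAt (fun h : ℝ => (1 - h) ^ m / (1 + h) ^ (m + 1)) 0 := by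
    refine ContinuousAt.div (by fun_prop) (by fun_prop) (by simp)
  have hlim : Filter.Tendsto (fun h : ℝ => ENNReal.ofReal ((1 - h) ^ m / (1 + h) ^ (m + 1)) *
      (volume : Measure E).toSphere s) (𝓝[>] 0) (𝓝 ((volume : Measure E).toSphere s)) := by
    have h2 := ENNReal.Tendsto.mul_const (b := (volume : Measure E).toSphere s)
      ((ENNReal.tendsto_ofReal hcont.tendsto).mono_left
      (nhdsWithin_le_nhds (s := Ioi 0))) (Or.inr (measure_ne_top _ s))
    simpa using h2
  refine le_of_tendsto hlim ?_
  filter_upwards [Ioo_mem_nhdsGT one_pos] with h hh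
  simpa using key h hh s

theorem volumeIoiPow_ofReal_lt_le (n : ℕ) (c : ℝ≥0∞) :
    Measure.volumeIoiPow n {r | ENNReal.ofReal r < c} ≤ c ^ (n + 1) / (n + 1) := by
  rcases eq_or_ne c ∞ with rfl | hc
  · simp [ENNReal.top_div]
  rcases eq_or_ne c 0 with rfl | hc0
  · simp
  have hpos := ENNReal.toReal_pos hc0 hc
  have : {r : Ioi (0 : ℝ) | ENNReal.ofReal r < c} = Iio ⟨c.toReal, hpos⟩ := by
    ext r
    exact ENNReal.ofReal_lt_iff_lt_toReal r.2.out.le hc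
  rw [this, Measure.volumeIoiPow_apply_Iio, ENNReal.ofReal_div_of_pos (by positivity),
    ENNReal.ofReal_pow hpos.le, ENNReal.ofReal_toReal hc]
  gcongr
  rw [ENNReal.ofReal_add (by positivity) zero_le_one]
  simp

theorem volume_norm_lt_radius_le {m : ℕ} (hE : Module.finrank ℝ E = m + 1)
    {R : E → ℝ≥0∞} (hR : Measurable R) :
    volume {x : E | x ≠ 0 ∧ ENNReal.ofReal ‖x‖ < R (‖x‖⁻¹ • x)} ≤
      ∫⁻ y : sphere (0 : E) 1, R y ^ (m + 1) / (m + 1) ∂(volume : Measure E).toSphere := by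
  set T : Set (sphere (0 : E) 1 × Ioi (0 : ℝ)) := {p | ENNReal.ofReal p.2 < R p.1}
  have hT : MeasurableSet T := measurableSet_lt (by fun_prop) (by fun_prop)
  have hset : {x : E | x ≠ 0 ∧ ENNReal.ofReal ‖x‖ < R (‖x‖⁻¹ • x)} =
      (↑) '' (homeomorphUnitSphereProd E ⁻¹' T) := by
    ext x
    simp [T, and_comm]
  have hmp := (volume : Measure E).measurePreserving_homeomorphUnitSphereProd
  rw [hset, ← comap_subtype_coe_apply (measurableSet_singleton _).compl,
    hmp.measure_preimage hT.nullMeasurableSet, Measure.prod_apply hT, hE]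
  exact lintegral_mono fun y => volumeIoiPow_ofReal_lt_le m _

omit [FiniteDimensional ℝ E] in
theorem lintegral_unitSphere_hausdorffMeasure (d : ℝ) (hd : 0 ≤ d) {ρ : ℝ} (hρ : 0 < ρ)
    {f : E → ℝ≥0∞} (hf : Measurable f) :
    ∫⁻ y : sphere (0 : E) 1, f (ρ • y) ∂μH[d] =
      ENNReal.ofReal ρ⁻¹ ^ d * ∫⁻ y in sphere (0 : E) ρ, f y ∂μH[d] := by
  have h1 : Measure.map ((↑) : sphere (0 : E) 1 → E) μH[d] = μH[d].restrict (sphere 0 1) := by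
    rw [isometry_subtype_coe.map_hausdorffMeasure (Or.inl hd), Subtype.range_coe]
  have h2 : Measure.map (fun x : E => ρ • x) μH[d] = ENNReal.ofReal ρ⁻¹ ^ d • μH[d] := by
    have h := map_homothety_hausdorffMeasure (P := E) hd 0 hρ.ne'
    have e : ⇑(AffineMap.homothety (0 : E) ρ) = fun x : E => ρ • x := by
      ext x
      simp [AffineMap.homothety_apply]
    rw [e] at h
    rw [h, ENNReal.smul_def, ENNReal.coe_rpow_of_nonneg _ hd, ← nnnorm_inv, ← enorm_eq_nnnorm,
      Real.enorm_of_nonneg (by positivity)]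
  have h3 : (fun x : E => ρ • x) ⁻¹' sphere 0 ρ = sphere 0 1 := by
    ext x
    simp [norm_smul, abs_of_pos hρ, hρ.ne']
  calc ∫⁻ y : sphere (0 : E) 1, f (ρ • y) ∂μH[d]
      = ∫⁻ y in sphere (0 : E) 1, f (ρ • y) ∂μH[d] := by
        rw [← h1, lintegral_map (by fun_prop) (by fun_prop)]
    _ = ∫⁻ y in sphere (0 : E) ρ, f y ∂(Measure.map (fun x : E => ρ • x) μH[d]) := by
        rw [← h3, setLIntegral_map isClosed_sphere.measurableSet hf (by fun_prop)]
    _ = _ := by rw [h2, Measure.restrict_smul, lintegral_smul_measure, smul_eq_mul]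

end

/-- Lemma 3.4 (quantitative content): the weak-type `(m+1)` bound for the radial
homogeneous extension. -/
theorem homogeneous_extension_weak_type (m : ℕ) (hm : 1 ≤ m) (ρ : ℝ) (hρ : 0 < ρ)
    (g : Euc (m + 1) → ℝ≥0∞) (hg : Measurable g) (t : ℝ) (ht : 0 < t) :
    volume {x : Euc (m + 1) | x ∈ ball (0 : Euc (m + 1)) ρ \ {0} ∧
        ENNReal.ofReal t < ENNReal.ofReal (ρ / ‖x‖) * g ((ρ / ‖x‖) • x)}
      ≤ ENNReal.ofReal (ρ / ((m + 1) * t ^ (m + 1))) *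
        ∫⁻ y in sphere (0 : Euc (m + 1)) ρ, g y ^ (m + 1) ∂ μH[(m : ℝ)] := by
  have hE : Module.finrank ℝ (Euc (m + 1)) = m + 1 := by simp
  set R : Euc (m + 1) → ℝ≥0∞ := fun x => ENNReal.ofReal (ρ / t) * g (ρ • x) with hRdef
  have hR : Measurable R := by fun_prop
  have hsub : {x : Euc (m + 1) | x ∈ ball (0 : Euc (m + 1)) ρ \ {0} ∧
        ENNReal.ofReal t < ENNReal.ofReal (ρ / ‖x‖) * g ((ρ / ‖x‖) • x)} ⊆
      {x | x ≠ 0 ∧ ENNReal.ofReal ‖x‖ < R (‖x‖⁻¹ • x)} := by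
    rintro x ⟨⟨-, hx0 : x ≠ 0⟩, hx⟩
    refine ⟨hx0, ?_⟩
    have hn : 0 < ‖x‖ := norm_pos_iff.2 hx0
    have hc : 0 < ENNReal.ofReal (‖x‖ / t) := ENNReal.ofReal_pos.2 (by positivity)
    have := (ENNReal.mul_lt_mul_iff_right hc.ne' ENNReal.ofReal_ne_top).2 hx
    rw [← mul_assoc, ← ENNReal.ofReal_mul (by positivity), ← ENNReal.ofReal_mul (by positivity),
      div_mul_cancel₀ _ ht.ne', div_mul_div_comm, mul_comm t, mul_div_mul_left _ _ hn.ne'] at this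
    simpa [hRdef, smul_smul, div_eq_mul_inv] using this
  calc _ ≤ _ := measure_mono hsub
    _ ≤ _ := volume_norm_lt_radius_le hE hR
    _ ≤ ∫⁻ y : sphere (0 : Euc (m + 1)) 1, R y ^ (m + 1) / (m + 1) ∂μH[(m : ℝ)] :=
        lintegral_mono' (toSphere_le_hausdorffMeasure hE) le_rfl
    _ = ENNReal.ofReal (ρ / t) ^ (m + 1) / (m + 1) *
        ∫⁻ y : sphere (0 : Euc (m + 1)) 1, g (ρ • y) ^ (m + 1) ∂μH[(m : ℝ)] := by
        rw [← lintegral_const_mul _ (by fun_prop)]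
        refine lintegral_congr fun y => ?_
        simp only [hRdef, mul_pow, div_eq_mul_inv]
        ring
    _ = _ := by
        rw [lintegral_unitSphere_hausdorffMeasure (m : ℝ) (by positivity) hρ
          (f := fun y => g y ^ (m + 1)) (by fun_prop), ← mul_assoc, ENNReal.rpow_natCast,
          ← ENNReal.ofReal_pow (by positivity), ← ENNReal.ofReal_pow (by positivity),
          show (m : ℝ≥0∞) + 1 = ENNReal.ofReal (m + 1) by
            rw [ENNReal.ofReal_add (by positivity) zero_le_one]; simp,
          ← ENNReal.ofReal_div_of_pos (by positivity), ← ENNReal.ofReal_mul (by positivity)]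
        congr 2
        rw [div_pow, inv_pow]
        field_simp
        ring
end
end

section
/- Let m ≥ 1 and ν ≥ 1 be integers and p ∈ [1,∞). For every Borel measurable map u : ℝ^m → ℝ^ν, one has ∫_0^∞ [ sup_{x∈ℝ^m} ⨍_{B_r(x)} ⨍_{B_r(x)} |u(y) − u(z)|^p dy dz ] dr/r ≤ (4^m / (2m·ω_m²)) · ∬_{ℝ^m×ℝ^m} |u(y) − u(z)|^p / |y−z|^{2m} dy dz, where ω_m := L^m(B_1) is the Lebesgue measure of the unit ball of ℝ^m and ⨍_{B_r(x)} denotes the average over the Euclidean ball of radius r centered at x with respect to Lebesgue measure. -/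
open MeasureTheory Metric Set
open scoped ENNReal Topology

noncomputable section

/-- Mean oscillation of `u` on the ball of radius `r` centered at `x`:
the double average of `|u(y) - u(z)|^p`. -/
def osc {m ν : ℕ} (p : ℝ) (u : Euc m → Euc ν) (x : Euc m) (r : ℝ) : ℝ≥0∞ :=
  (volume (ball x r))⁻¹ * (volume (ball x r))⁻¹ *
    ∫⁻ y in ball x r, ∫⁻ z in ball x r, ENNReal.ofReal (dist (u y) (u z) ^ p)

/-- The oscillation on a ball is controlled by the near-diagonal energy on the whole space. -/
theorem osc_le_lintegral_near_diagonal {m ν : ℕ} (p : ℝ) (u : Euc m → Euc ν) (x : Euc m)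
    {r : ℝ} (hr : 0 < r) :
    osc p u x r * ENNReal.ofReal r⁻¹ ≤
      ENNReal.ofReal ((volume (ball (0 : Euc m) 1)).toReal ^ 2)⁻¹ *
        ∫⁻ y, ∫⁻ z, ENNReal.ofReal (dist (u y) (u z) ^ p) *
          (Ioi (dist y z / 2)).indicator
            (fun r => ENNReal.ofReal (r ^ (-(2 * m + 1 : ℝ)))) r := by
  set w := (volume (ball (0 : Euc m) 1)).toReal with hw
  have hw0 : 0 < w := ENNReal.toReal_pos (measure_ball_pos _ _ one_pos).ne' measure_ball_lt_top.ne
  have hvol : volume (ball x r) = ENNReal.ofReal (r ^ m * w) := by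
    rw [Measure.addHaar_ball_of_pos _ _ hr, ENNReal.ofReal_mul (by positivity), hw,
      ENNReal.ofReal_toReal measure_ball_lt_top.ne, finrank_euclideanSpace_fin]
  have hconst : (volume (ball x r))⁻¹ * (volume (ball x r))⁻¹ * ENNReal.ofReal r⁻¹ =
      ENNReal.ofReal (w ^ 2)⁻¹ * ENNReal.ofReal (r ^ (-(2 * m + 1 : ℝ))) := by
    rw [hvol, ← ENNReal.ofReal_inv_of_pos (by positivity), ← ENNReal.ofReal_mul (by positivity),
      ← ENNReal.ofReal_mul (by positivity), ← ENNReal.ofReal_mul (by positivity),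
      Real.rpow_neg hr.le]
    have : r ^ (2 * m + 1 : ℝ) = r ^ (2 * m + 1 : ℕ) := by
      rw [← Real.rpow_natCast]; push_cast; rfl
    rw [this]
    congr 1
    field_simp
    ring
  rw [osc, mul_right_comm, hconst, mul_assoc]
  gcongr
  rw [← lintegral_const_mul' _ _ ENNReal.ofReal_ne_top, ← lintegral_indicator measurableSet_ball]
  refine lintegral_mono fun y => ?_
  by_cases hy : y ∈ ball x r
  · rw [indicator_of_mem hy, ← lintegral_const_mul' _ _ ENNReal.ofReal_ne_top,
      ← lintegral_indicator measurableSet_ball]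
    refine lintegral_mono fun z => ?_
    by_cases hz : z ∈ ball x r
    · have h : r ∈ Ioi (dist y z / 2) := by
        have := dist_triangle_right y z x
        rw [mem_ball] at hy hz
        rw [mem_Ioi]
        linarith
      simp only [indicator_of_mem hz, indicator_of_mem h]
      rw [mul_comm]
    · simp [indicator_of_notMem hz]
  · simp [indicator_of_notMem hy]

/-- The tail integral of `r ^ (-(2m+1))` from half a positive number. -/
theorem lintegral_Ioi_half_rpow {m : ℕ} (hm : 1 ≤ m) {d : ℝ} (hd : 0 < d) :
    ∫⁻ r in Ioi (d / 2), ENNReal.ofReal (r ^ (-(2 * m + 1 : ℝ))) =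
      ENNReal.ofReal (4 ^ m / (2 * m)) / ENNReal.ofReal (d ^ (2 * m)) := by
  have hm' : (1 : ℝ) ≤ m := by exact_mod_cast hm
  have hlt : -(2 * m + 1 : ℝ) < -1 := by linarith
  have hd2 : 0 < d / 2 := by positivity
  rw [← ofReal_integral_eq_lintegral_ofReal (integrableOn_Ioi_rpow_of_lt hlt hd2)
    ((ae_restrict_iff' measurableSet_Ioi).2 <| .of_forall fun r hr =>
      Real.rpow_nonneg (hd2.le.trans (le_of_lt hr)) _),
    integral_Ioi_rpow_of_lt hlt hd2, ← ENNReal.ofReal_div_of_pos (by positivity)]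
  have h1 : -(2 * m + 1 : ℝ) + 1 = -((2 * m : ℕ) : ℝ) := by push_cast; ring
  have h4 : (4 : ℝ) ^ m = 2 ^ (2 * m) := by rw [pow_mul]; norm_num
  rw [h1, Real.rpow_neg hd2.le, Real.rpow_natCast, div_pow, h4]
  congr 1
  push_cast
  field_simp

/-- The scale-integrated maximal mean oscillation estimate (equation (1.8)). -/
theorem integrated_maximal_oscillation (m ν : ℕ) (hm : 1 ≤ m) (hν : 1 ≤ ν)
    (p : ℝ) (hp : 1 ≤ p) (u : Euc m → Euc ν) (hu : Measurable u) :
    (∫⁻ r in Ioi (0 : ℝ), (⨆ x : Euc m, osc p u x r) * ENNReal.ofReal r⁻¹)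
      ≤ ENNReal.ofReal
          ((4 : ℝ) ^ m / (2 * m * (volume (ball (0 : Euc m) 1)).toReal ^ 2)) *
        ∫⁻ y, ∫⁻ z, ENNReal.ofReal (dist (u y) (u z) ^ p) /
          ENNReal.ofReal (dist y z ^ (2 * m)) := by
  have hp0 : 0 < p := zero_lt_one.trans_le hp
  have hG : Measurable fun q : Euc m × Euc m => ENNReal.ofReal (dist (u q.1) (u q.2) ^ p) := by
    fun_prop
  have hF : Measurable fun a : ℝ × (Euc m × Euc m) =>
      ENNReal.ofReal (dist (u a.2.1) (u a.2.2) ^ p) *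
        (Ioi (dist a.2.1 a.2.2 / 2)).indicator
          (fun r => ENNReal.ofReal (r ^ (-(2 * m + 1 : ℝ)))) a.1 := by
    refine (hG.comp measurable_snd).mul ?_
    have hS : MeasurableSet {a : ℝ × (Euc m × Euc m) | dist a.2.1 a.2.2 / 2 < a.1} :=
      measurableSet_lt (by fun_prop) (by fun_prop)
    exact (show Measurable fun a : ℝ × (Euc m × Euc m) =>
      ENNReal.ofReal (a.1 ^ (-(2 * m + 1 : ℝ))) by fun_prop).indicator hS
  set w := (volume (ball (0 : Euc m) 1)).toReal with hw
  have hw0 : 0 < w := ENNReal.toReal_pos (measure_ball_pos _ _ one_pos).ne' measure_ball_lt_top.ne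
  have hm0 : (0 : ℝ) < m := by exact_mod_cast hm
  calc _ ≤ ∫⁻ r in Ioi (0 : ℝ), ENNReal.ofReal (w ^ 2)⁻¹ *
        ∫⁻ y, ∫⁻ z, ENNReal.ofReal (dist (u y) (u z) ^ p) *
          (Ioi (dist y z / 2)).indicator
            (fun r => ENNReal.ofReal (r ^ (-(2 * m + 1 : ℝ)))) r := by
        refine setLIntegral_mono' measurableSet_Ioi fun r hr => ?_
        rw [ENNReal.iSup_mul]
        exact iSup_le fun x => osc_le_lintegral_near_diagonal p u x hr
    _ = ENNReal.ofReal (w ^ 2)⁻¹ * ∫⁻ r in Ioi (0 : ℝ), ∫⁻ q : Euc m × Euc m,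
          ENNReal.ofReal (dist (u q.1) (u q.2) ^ p) *
          (Ioi (dist q.1 q.2 / 2)).indicator
            (fun r => ENNReal.ofReal (r ^ (-(2 * m + 1 : ℝ)))) r := by
        rw [lintegral_const_mul' _ _ ENNReal.ofReal_ne_top]
        congr 1
        refine lintegral_congr fun r => ?_
        exact (lintegral_prod _
          (hF.comp (measurable_const.prodMk measurable_id)).aemeasurable).symm
    _ = ENNReal.ofReal (w ^ 2)⁻¹ * ∫⁻ q : Euc m × Euc m, ∫⁻ r in Ioi (0 : ℝ),
          ENNReal.ofReal (dist (u q.1) (u q.2) ^ p) *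
          (Ioi (dist q.1 q.2 / 2)).indicator
            (fun r => ENNReal.ofReal (r ^ (-(2 * m + 1 : ℝ)))) r := by
        rw [lintegral_lintegral_swap hF.aemeasurable]
    _ = ENNReal.ofReal (w ^ 2)⁻¹ * ∫⁻ q : Euc m × Euc m, ENNReal.ofReal (4 ^ m / (2 * m)) *
          (ENNReal.ofReal (dist (u q.1) (u q.2) ^ p) /
            ENNReal.ofReal (dist q.1 q.2 ^ (2 * m))) := by
        congr 1
        refine lintegral_congr fun q => ?_
        rw [lintegral_const_mul' _ _ ENNReal.ofReal_ne_top]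
        rcases eq_or_ne q.1 q.2 with h | h
        · simp [h, Real.zero_rpow hp0.ne']
        · have hd := dist_pos.2 h
          rw [setLIntegral_indicator measurableSet_Ioi,
            inter_eq_left.2 (Ioi_subset_Ioi (by positivity)), lintegral_Ioi_half_rpow hm hd]
          simp only [div_eq_mul_inv]
          ring
    _ = _ := by
        rw [lintegral_const_mul' _ _ ENNReal.ofReal_ne_top, ← mul_assoc,
          ← ENNReal.ofReal_mul (by positivity), Measure.volume_eq_prod,
          lintegral_prod _ (by fun_prop)]
        congr 2
        field_simp
end
end

section
/- Let m ≥ 1 and ν ≥ 1 be integers and p ∈ [1,∞). For every Borel measurable map u : ℝ^m → ℝ^ν and every λ ∈ (1,∞), there exists τ ∈ (1,λ) such that Σ_{k∈ℤ} sup_{x∈ℝ^m} ⨍_{B_{τλ^{−k}}(x)} ⨍_{B_{τλ^{−k}}(x)} |u(y) − u(z)|^p dy dz ≤ (4^m / (2m·ω_m²·ln λ)) · ∬_{ℝ^m×ℝ^m} |u(y) − u(z)|^p / |y−z|^{2m} dy dz, where ω_m := L^m(B_1) is the Lebesgue measure of the unit ball of ℝ^m and ⨍_{B_r(x)} denotes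 the average over the Euclidean ball of radius r centered at x with respect to Lebesgue measure. -/
open MeasureTheory Metric Set
open scoped ENNReal Topology

noncomputable section

/-- The integral over one period of the periodization of `H` is the integral of `H`. -/
theorem lintegral_Ioc_tsum_sub_int_mul {L : ℝ} (hL : 0 < L) {H : ℝ → ℝ≥0∞} (hH : Measurable H) :
    ∫⁻ s in Ioc 0 L, ∑' k : ℤ, H (s - k * L) = ∫⁻ s, H s := by
  rw [lintegral_tsum fun k => by fun_prop]
  have hdom := isAddFundamentalDomain_Ioc hL 0
  rw [hdom.lintegral_eq_tsum', zero_add]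
  let e : ℤ ≃ AddSubgroup.zmultiples L :=
    Equiv.ofInjective (fun n : ℤ => n • L) (zsmul_left_strictMono hL).injective
  rw [← e.tsum_eq]
  refine tsum_congr fun k => lintegral_congr fun s => ?_
  congr 1
  change s - k * L = -(k • L) + s
  rw [zsmul_eq_mul]
  ring

/-- The truncated power `r ^ (-n)` on `2 r > d`, in the logarithmic variable `s = log r`. -/
def truncPow (n : ℕ) (d s : ℝ) : ℝ≥0∞ :=
  {q : ℝ × ℝ | q.1 < 2 * Real.exp q.2}.indicator
    (fun q => ENNReal.ofReal (Real.exp (-(n : ℝ) * q.2))) (d, s)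

theorem measurable_truncPow (n : ℕ) : Measurable fun q : ℝ × ℝ => truncPow n q.1 q.2 :=
  Measurable.indicator (by fun_prop) (measurableSet_lt (by fun_prop) (by fun_prop))

theorem lintegral_truncPow {n : ℕ} (hn : 0 < n) {d : ℝ} (hd : 0 < d) :
    ∫⁻ s, truncPow n d s = ENNReal.ofReal (2 ^ n / n) / ENNReal.ofReal (d ^ n) := by
  have hn' : (0 : ℝ) < n := Nat.cast_pos.2 hn
  have heq : ∀ s, truncPow n d s =
      (Ioi (Real.log (d / 2))).indicator (fun s => ENNReal.ofReal (Real.exp (-(n : ℝ) * s))) s := by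
    intro s
    have : d < 2 * Real.exp s ↔ s ∈ Ioi (Real.log (d / 2)) := by
      rw [mem_Ioi, Real.log_lt_iff_lt_exp (by positivity), div_lt_iff₀' two_pos]
    simp only [truncPow, indicator, mem_ofPred_eq, this]
  simp_rw [heq]
  rw [lintegral_indicator measurableSet_Ioi,
    ← ofReal_integral_eq_lintegral_ofReal (integrableOn_exp_mul_Ioi (neg_neg_of_pos hn') _)
      (ae_of_all _ fun s => (Real.exp_pos _).le),
    integral_exp_mul_Ioi (neg_neg_of_pos hn'), ← ENNReal.ofReal_div_of_pos (by positivity)]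
  congr 1
  rw [neg_mul, Real.exp_neg, mul_comm (n : ℝ), Real.exp_mul, Real.exp_log (by positivity),
    Real.rpow_natCast, div_pow]
  field_simp

/-- The oscillation on balls of radius `exp s` is bounded by an integral over a tubular
neighborhood of the diagonal, independently of the center of the ball. -/
theorem osc_exp_le {m ν : ℕ} (p : ℝ) (u : Euc m → Euc ν) (x : Euc m) (s : ℝ) :
    osc p u x (Real.exp s) ≤
      (volume (ball (0 : Euc m) 1))⁻¹ * (volume (ball (0 : Euc m) 1))⁻¹ *
        ∫⁻ y, ∫⁻ z, ENNReal.ofReal (dist (u y) (u z) ^ p) * truncPow (2 * m) (dist y z) s := by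
  set V := volume (ball (0 : Euc m) 1) with hV
  have hVtop : V ≠ ∞ := measure_ball_lt_top.ne
  have hvol : (volume (ball x (Real.exp s)))⁻¹ = ENNReal.ofReal (Real.exp (-(m * s))) * V⁻¹ := by
    rw [Measure.addHaar_ball_of_pos _ _ (Real.exp_pos s), finrank_euclideanSpace_fin,
      ENNReal.mul_inv (Or.inr hVtop) (Or.inl ENNReal.ofReal_ne_top),
      ← ENNReal.ofReal_inv_of_pos (by positivity), ← Real.exp_nat_mul, Real.exp_neg]
  have hexp : ENNReal.ofReal (Real.exp (-(m * s))) * ENNReal.ofReal (Real.exp (-(m * s))) =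
      ENNReal.ofReal (Real.exp (-((2 * m : ℕ) : ℝ) * s)) := by
    rw [← ENNReal.ofReal_mul (Real.exp_pos _).le, ← Real.exp_add]
    push_cast
    ring_nf
  rw [osc, hvol, mul_mul_mul_comm, hexp, mul_comm (ENNReal.ofReal _), mul_assoc,
    ← lintegral_const_mul' _ _ ENNReal.ofReal_ne_top]
  refine mul_le_mul' le_rfl ?_
  refine le_trans (setLIntegral_mono' measurableSet_ball fun y hy => ?_)
    (setLIntegral_le_lintegral _ _)
  rw [← lintegral_const_mul' _ _ ENNReal.ofReal_ne_top]
  refine le_trans (setLIntegral_mono' measurableSet_ball fun z hz => ?_)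
    (setLIntegral_le_lintegral _ _)
  have hlt : dist y z < 2 * Real.exp s := by
    rw [mem_ball] at hy hz
    linarith [dist_triangle_right y z x]
  rw [truncPow, indicator_of_mem (by exact hlt), mul_comm]

theorem measurable_dist_rpow_mul_truncPow {m ν : ℕ} (n : ℕ) (p : ℝ) {u : Euc m → Euc ν}
    (hu : Measurable u) :
    Measurable fun q : (ℝ × Euc m) × Euc m =>
      ENNReal.ofReal (dist (u q.1.2) (u q.2) ^ p) * truncPow n (dist q.1.2 q.2) q.1.1 := by
  have : Measurable fun q : (ℝ × Euc m) × Euc m => truncPow n (dist q.1.2 q.2) q.1.1 :=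
    (measurable_truncPow n).comp (by fun_prop : Measurable
      fun q : (ℝ × Euc m) × Euc m => (dist q.1.2 q.2, q.1.1))
  fun_prop

/-- The scale-integrated mean oscillation estimate, in the logarithmic variable. -/
theorem lintegral_truncPow_energy {m ν : ℕ} (hm : 1 ≤ m) {p : ℝ} (hp : p ≠ 0)
    {u : Euc m → Euc ν} (hu : Measurable u) :
    ∫⁻ s, ∫⁻ y, ∫⁻ z, ENNReal.ofReal (dist (u y) (u z) ^ p) * truncPow (2 * m) (dist y z) s =
      ENNReal.ofReal (4 ^ m / (2 * m)) *
        ∫⁻ y, ∫⁻ z, ENNReal.ofReal (dist (u y) (u z) ^ p) /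
          ENNReal.ofReal (dist y z ^ (2 * m)) := by
  have hF := measurable_dist_rpow_mul_truncPow (2 * m) p hu
  rw [lintegral_lintegral_swap hF.lintegral_prod_right'.aemeasurable,
    ← lintegral_const_mul' _ _ ENNReal.ofReal_ne_top]
  refine lintegral_congr fun y => ?_
  have hFy := hF.comp (by fun_prop : Measurable fun q : ℝ × Euc m => ((q.1, y), q.2))
  rw [lintegral_lintegral_swap (by exact hFy.aemeasurable),
    ← lintegral_const_mul' _ _ ENNReal.ofReal_ne_top]
  refine lintegral_congr fun z => ?_
  rw [lintegral_const_mul' _ _ ENNReal.ofReal_ne_top]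
  rcases eq_or_ne y z with rfl | hyz
  · simp [Real.zero_rpow hp]
  · rw [lintegral_truncPow (by lia) (dist_pos.2 hyz), pow_mul]
    push_cast
    norm_num only
    simp only [div_eq_mul_inv]
    ring

/-- The Chebyshev-type scale-selection inequality (equation (1.9)). -/
theorem scale_selection (m ν : ℕ) (hm : 1 ≤ m) (hν : 1 ≤ ν)
    (p : ℝ) (hp : 1 ≤ p) (u : Euc m → Euc ν) (hu : Measurable u)
    (lam : ℝ) (hlam : 1 < lam) :
    ∃ τ ∈ Ioo (1 : ℝ) lam,
      (∑' k : ℤ, ⨆ x : Euc m, osc p u x (τ * lam ^ (-k)))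
        ≤ ENNReal.ofReal
            ((4 : ℝ) ^ m /
              (2 * m * (volume (ball (0 : Euc m) 1)).toReal ^ 2 * Real.log lam)) *
          ∫⁻ y, ∫⁻ z, ENNReal.ofReal (dist (u y) (u z) ^ p) /
            ENNReal.ofReal (dist y z ^ (2 * m)) := by
  have hL : 0 < Real.log lam := Real.log_pos hlam
  have hlam0 : 0 < lam := one_pos.trans hlam
  set V := volume (ball (0 : Euc m) 1) with hV
  have hVtop : V ≠ ∞ := measure_ball_lt_top.ne
  have hV0 : V ≠ 0 := (measure_ball_pos _ _ one_pos).ne'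
  have hVpos : 0 < V.toReal := ENNReal.toReal_pos hV0 hVtop
  have hVinv : V⁻¹ * V⁻¹ ≠ ∞ := by finiteness
  set E : ℝ → ℝ≥0∞ := fun s =>
    ∫⁻ y, ∫⁻ z, ENNReal.ofReal (dist (u y) (u z) ^ p) * truncPow (2 * m) (dist y z) s with hE
  have hEm : Measurable E :=
    (measurable_dist_rpow_mul_truncPow (2 * m) p hu).lintegral_prod_right'.lintegral_prod_right'
  set G : ℝ → ℝ≥0∞ := fun s => V⁻¹ * V⁻¹ * E s with hG
  have hGm : Measurable G := hEm.const_mul _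
  have hvol : volume (Ioo 0 (Real.log lam)) = ENNReal.ofReal (Real.log lam) := by simp
  obtain ⟨s, hs, hle⟩ := exists_le_setLAverage (μ := volume) (s := Ioo 0 (Real.log lam))
    (f := fun s => ∑' k : ℤ, G (s - k * Real.log lam)) (by simpa [hvol] using hL) (by simp [hvol])
    (Measurable.tsum fun k => hGm.comp (measurable_id.sub_const _)).aemeasurable
  refine ⟨Real.exp s, ⟨Real.one_lt_exp_iff.2 hs.1, (Real.lt_log_iff_exp_lt hlam0).1 hs.2⟩, ?_⟩
  have hterm : ∀ k : ℤ, ⨆ x : Euc m, osc p u x (Real.exp s * lam ^ (-k)) ≤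
      G (s - k * Real.log lam) := by
    intro k
    have hr : Real.exp s * lam ^ (-k) = Real.exp (s - k * Real.log lam) := by
      rw [Real.exp_sub, mul_comm (k : ℝ), Real.exp_mul, Real.exp_log hlam0, Real.rpow_intCast,
        zpow_neg, div_eq_mul_inv]
    exact iSup_le fun x => hr ▸ osc_exp_le p u x _
  refine (ENNReal.tsum_le_tsum hterm).trans (hle.trans_eq ?_)
  rw [setLAverage_eq, hvol, setLIntegral_congr Ioo_ae_eq_Ioc,
    lintegral_Ioc_tsum_sub_int_mul hL hGm, lintegral_const_mul' _ _ hVinv,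
    lintegral_truncPow_energy hm (by positivity) hu]
  have hC : ENNReal.ofReal ((4 : ℝ) ^ m / (2 * m * V.toReal ^ 2 * Real.log lam)) =
      V⁻¹ * V⁻¹ * ENNReal.ofReal (4 ^ m / (2 * m)) * (ENNReal.ofReal (Real.log lam))⁻¹ := by
    have hVr : V⁻¹ = ENNReal.ofReal V.toReal⁻¹ := by
      rw [ENNReal.ofReal_inv_of_pos hVpos, ENNReal.ofReal_toReal hVtop]
    rw [hVr, ← ENNReal.ofReal_inv_of_pos hL, ← ENNReal.ofReal_mul (by positivity),
      ← ENNReal.ofReal_mul (by positivity), ← ENNReal.ofReal_mul (by positivity)]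
    congr 1
    field_simp
  rw [hC, div_eq_mul_inv]
  ring
end
end

section
/- Let m ≥ 1 and ν ≥ 1 be integers and p ∈ [1,∞). If u : ℝ^m → ℝ^ν is Borel measurable and ∬_{ℝ^m×ℝ^m} |u(y) − u(z)|^p / |y−z|^{2m} dy dz < ∞, then lim_{r→0⁺} sup_{x∈ℝ^m} ⨍_{B_r(x)} ⨍_{B_r(x)} |u(y) − u(z)|^p dy dz = 0, where ⨍_{B_r(x)} denotes the average over the Euclidean ball of radius r centered at x with respect to Lebesgue measure. -/
open MeasureTheory Metric Set Filter
open scoped ENNReal Topology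

noncomputable section

/-- The integrand of the critical Gagliardo energy of `u`. -/
def gagliardo {m ν : ℕ} (p : ℝ) (u : Euc m → Euc ν) (q : Euc m × Euc m) : ℝ≥0∞ :=
  ENNReal.ofReal (dist (u q.1) (u q.2) ^ p) / ENNReal.ofReal (dist q.1 q.2 ^ (2 * m))

lemma measurable_gagliardo {m ν : ℕ} (p : ℝ) {u : Euc m → Euc ν} (hu : Measurable u) :
    Measurable (gagliardo p u) := by
  unfold gagliardo
  have h1 : Measurable fun q : Euc m × Euc m => dist (u q.1) (u q.2) :=
    (hu.comp measurable_fst).dist (hu.comp measurable_snd)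
  have h2 : Measurable fun q : Euc m × Euc m => dist q.1 q.2 :=
    measurable_fst.dist measurable_snd
  exact (h1.pow_const p).ennreal_ofReal.div (h2.pow_const _).ennreal_ofReal

lemma gagliardo_self {m ν : ℕ} {p : ℝ} (hp : p ≠ 0) (u : Euc m → Euc ν) (y : Euc m) :
    gagliardo p u (y, y) = 0 := by
  simp [gagliardo, Real.zero_rpow hp]

/-- The Gagliardo integrand restricted to pairs of points at distance less than `δ`. -/
def nearGagliardo {m ν : ℕ} (p : ℝ) (u : Euc m → Euc ν) (δ : ℝ) : Euc m × Euc m → ℝ≥0∞ :=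
  {q : Euc m × Euc m | dist q.1 q.2 < δ}.indicator (gagliardo p u)

lemma measurable_nearGagliardo {m ν : ℕ} (p : ℝ) {u : Euc m → Euc ν} (hu : Measurable u)
    (δ : ℝ) : Measurable (nearGagliardo p u δ) :=
  (measurable_gagliardo p hu).indicator
    (measurableSet_lt (measurable_fst.dist measurable_snd) measurable_const)

/-- The energy concentrated near the diagonal vanishes, by dominated convergence. -/
lemma tendsto_lintegral_nearGagliardo {m ν : ℕ} {p : ℝ} (hp : p ≠ 0) {u : Euc m → Euc ν}
    (hu : Measurable u) (hE : (∫⁻ q, gagliardo p u q) ≠ ⊤) :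
    Tendsto (fun r : ℝ => ∫⁻ q, nearGagliardo p u (2 * r) q) (𝓝[>] 0) (𝓝 0) := by
  have h : Tendsto (fun r : ℝ => ∫⁻ q, nearGagliardo p u (2 * r) q) (𝓝[>] 0)
      (𝓝 (∫⁻ _ : Euc m × Euc m, 0)) := by
    refine tendsto_lintegral_filter_of_dominated_convergence (gagliardo p u)
      (.of_forall fun r => measurable_nearGagliardo p hu _)
      (.of_forall fun r => .of_forall fun q => indicator_le_self _ _ q) hE
      (.of_forall fun q => ?_)
    obtain ⟨y, z⟩ := q
    rcases eq_or_ne y z with rfl | hyz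
    · simp [nearGagliardo, indicator_apply, gagliardo_self hp]
    · refine tendsto_const_nhds.congr' ?_
      have h0 : (0 : ℝ) < dist y z / 2 := half_pos (dist_pos.2 hyz)
      filter_upwards [mem_nhdsWithin_of_mem_nhds (Iio_mem_nhds h0)] with r hr
      have hr' : r < dist y z / 2 := hr
      have : ¬ dist y z < 2 * r := by linarith
      simp [nearGagliardo, this]
  simpa using h

lemma ofReal_dist_rpow_le {m ν : ℕ} {p : ℝ} (hp : p ≠ 0) (u : Euc m → Euc ν) {δ : ℝ}
    {y z : Euc m} (h : dist y z < δ) :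
    ENNReal.ofReal (dist (u y) (u z) ^ p) ≤
      ENNReal.ofReal δ ^ (2 * m) * nearGagliardo p u δ (y, z) := by
  rcases eq_or_ne y z with rfl | hyz
  · simp [Real.zero_rpow hp]
  have hd : 0 < dist y z := dist_pos.2 hyz
  have hmem : (y, z) ∈ {q : Euc m × Euc m | dist q.1 q.2 < δ} := h
  rw [nearGagliardo, indicator_of_mem hmem, gagliardo]
  have h0 : ENNReal.ofReal (dist y z ^ (2 * m)) ≠ 0 :=
    (ENNReal.ofReal_pos.2 (pow_pos hd _)).ne'
  calc ENNReal.ofReal (dist (u y) (u z) ^ p)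
      = ENNReal.ofReal (dist y z ^ (2 * m)) * (ENNReal.ofReal (dist (u y) (u z) ^ p) /
          ENNReal.ofReal (dist y z ^ (2 * m))) :=
        (ENNReal.mul_div_cancel h0 ENNReal.ofReal_ne_top).symm
    _ ≤ _ := by
        gcongr
        rw [ENNReal.ofReal_pow hd.le]
        gcongr

lemma osc_le {m ν : ℕ} {p : ℝ} (hp : p ≠ 0) {u : Euc m → Euc ν} (hu : Measurable u)
    (x : Euc m) {r : ℝ} (hr : 0 < r) :
    osc p u x r ≤ (volume (ball (0 : Euc m) 1))⁻¹ ^ 2 * 2 ^ (2 * m) *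
      ∫⁻ q, nearGagliardo p u (2 * r) q := by
  have hI : (∫⁻ y in ball x r, ∫⁻ z in ball x r, ENNReal.ofReal (dist (u y) (u z) ^ p)) ≤
      ENNReal.ofReal (2 * r) ^ (2 * m) * ∫⁻ q, nearGagliardo p u (2 * r) q := by
    have hmeas := measurable_nearGagliardo p hu (2 * r)
    calc (∫⁻ y in ball x r, ∫⁻ z in ball x r, ENNReal.ofReal (dist (u y) (u z) ^ p))
        ≤ ∫⁻ y in ball x r, ∫⁻ z in ball x r,
            ENNReal.ofReal (2 * r) ^ (2 * m) * nearGagliardo p u (2 * r) (y, z) := by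
          refine setLIntegral_mono' measurableSet_ball fun y hy =>
            setLIntegral_mono' measurableSet_ball fun z hz => ofReal_dist_rpow_le hp u ?_
          have := dist_triangle_right y z x
          rw [mem_ball] at hy hz
          linarith
      _ ≤ ∫⁻ y, ∫⁻ z, ENNReal.ofReal (2 * r) ^ (2 * m) * nearGagliardo p u (2 * r) (y, z) :=
          (setLIntegral_le_lintegral _ _).trans
            (lintegral_mono fun y => setLIntegral_le_lintegral _ _)
      _ = ENNReal.ofReal (2 * r) ^ (2 * m) * ∫⁻ q, nearGagliardo p u (2 * r) q := by
          rw [← lintegral_const_mul _ hmeas, Measure.volume_eq_prod,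
            lintegral_prod _ (hmeas.const_mul _).aemeasurable]
  have hA0 : ENNReal.ofReal r ^ m ≠ 0 := pow_ne_zero _ (ENNReal.ofReal_pos.2 hr).ne'
  have hAt : ENNReal.ofReal r ^ m ≠ ⊤ := ENNReal.pow_ne_top ENNReal.ofReal_ne_top
  have hvol : (volume (ball x r))⁻¹ =
      (ENNReal.ofReal r ^ m)⁻¹ * (volume (ball (0 : Euc m) 1))⁻¹ := by
    rw [Measure.addHaar_ball_of_pos _ x hr, finrank_euclideanSpace_fin, ENNReal.ofReal_pow hr.le,
      ENNReal.mul_inv (.inl hA0) (.inl hAt)]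
  refine (mul_le_mul_right hI _).trans_eq ?_
  rw [hvol, ENNReal.ofReal_mul zero_le_two, ENNReal.ofReal_ofNat, mul_pow, two_mul m, pow_add
    (ENNReal.ofReal r)]
  set A := ENNReal.ofReal r ^ m
  set V := (volume (ball (0 : Euc m) 1))⁻¹
  set J := ∫⁻ q, nearGagliardo p u (2 * r) q
  calc A⁻¹ * V * (A⁻¹ * V) * (2 ^ (m + m) * (A * A) * J)
      = (A⁻¹ * A) * (A⁻¹ * A) * (V ^ 2 * 2 ^ (m + m) * J) := by ring
    _ = V ^ 2 * 2 ^ (m + m) * J := by rw [ENNReal.inv_mul_cancel hA0 hAt, one_mul, one_mul]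

/-- The vanishing mean oscillation property of critical fractional Sobolev maps
(equation (1.6)). -/
theorem vanishing_mean_oscillation (m ν : ℕ) (hm : 1 ≤ m) (hν : 1 ≤ ν)
    (p : ℝ) (hp : 1 ≤ p) (u : Euc m → Euc ν) (hu : Measurable u)
    (hE : (∫⁻ y, ∫⁻ z, ENNReal.ofReal (dist (u y) (u z) ^ p) /
        ENNReal.ofReal (dist y z ^ (2 * m))) ≠ ⊤) :
    Tendsto (fun r : ℝ => ⨆ x : Euc m, osc p u x r)
      (nhdsWithin 0 (Ioi 0)) (nhds 0) := by
  have hp0 : p ≠ 0 := by linarith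
  have hE' : (∫⁻ q, gagliardo p u q) ≠ ⊤ := by
    rwa [Measure.volume_eq_prod, lintegral_prod _ (measurable_gagliardo p hu).aemeasurable]
  have hC : (volume (ball (0 : Euc m) 1))⁻¹ ^ 2 * 2 ^ (2 * m) ≠ ⊤ :=
    ENNReal.mul_ne_top
      (ENNReal.pow_ne_top (ENNReal.inv_ne_top.2 (measure_ball_pos _ _ one_pos).ne'))
      (ENNReal.pow_ne_top ENNReal.ofNat_ne_top)
  have hlim := ENNReal.Tendsto.const_mul (tendsto_lintegral_nearGagliardo hp0 hu hE')
    (Or.inr hC)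
  rw [mul_zero] at hlim
  refine tendsto_of_tendsto_of_tendsto_of_le_of_le' tendsto_const_nhds hlim
    (.of_forall fun _ => zero_le) ?_
  filter_upwards [self_mem_nhdsWithin] with r hr
  exact iSup_le fun x => osc_le hp0 hu x hr
end
end

section
/- Let m ≥ 1 be an integer, p ∈ [1,∞), (N,d) a compact metric space and u : ℝ^m → N Borel measurable. For every x = (x', x_{m+1}) ∈ ℝ^{m+1}_+ and every δ ∈ [0,∞), one has ⨍_{B_{x_{m+1}}(x')} MO^♯_{δ,p}u(z, x_{m+1}) dz ≤ 2^{2m} · MO_{δ,p}u(x', 2x_{m+1}). -/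
open MeasureTheory Metric Set
open scoped ENNReal Topology

noncomputable section

/-- Sharp truncated mean oscillation `MO♯_{δ,p}u(x', r)`:
`inf_{z ∈ ℝ^m} ⨍_{B_r(x')} (d(u y, u z) - δ)₊^p dy`. -/
def MOsharp {N : Type} [PseudoMetricSpace N] {m : ℕ} (p δ : ℝ) (u : Euc m → N)
    (x' : Euc m) (r : ℝ) : ℝ≥0∞ :=
  ⨅ z : Euc m, (volume (ball x' r))⁻¹ *
    ∫⁻ y in ball x' r, ENNReal.ofReal (max (dist (u y) (u z) - δ) 0 ^ p)

/-- Doubling the radius of a ball in `ℝ^m` multiplies its volume by `2 ^ m`. -/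
theorem volume_ball_two_mul {m : ℕ} (x : Euc m) (t : ℝ) :
    volume (ball x (2 * t)) = 2 ^ m * volume (ball x t) := by
  rw [Measure.addHaar_ball_mul_of_pos volume x two_pos t, Measure.addHaar_ball_center volume x t,
    finrank_euclideanSpace_fin, ENNReal.ofReal_pow zero_le_two, ENNReal.ofReal_ofNat]

/-- The infimum defining `MOsharp` is bounded by its value at the center, averaged over any
larger set. -/
theorem MOsharp_le_of_subset {N : Type} [PseudoMetricSpace N] {m : ℕ} (p δ : ℝ) (u : Euc m → N)
    (z : Euc m) (t : ℝ) {s : Set (Euc m)} (hs : ball z t ⊆ s) :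
    MOsharp p δ u z t ≤ (volume (ball z t))⁻¹ *
      ∫⁻ y in s, ENNReal.ofReal (max (dist (u z) (u y) - δ) 0 ^ p) := by
  refine (iInf_le _ z).trans ?_
  simp_rw [dist_comm (u z)]
  gcongr

/-- Fubini-type averaged bound on the sharp truncated mean oscillation:
`⨍_{B_{x_{m+1}}(x')} MO♯_{δ,p}u(z, x_{m+1}) dz ≤ 2^{2m} · MO_{δ,p}u(x', 2x_{m+1})`. -/
theorem avg_MOsharp_le (m : ℕ) (hm : 1 ≤ m) (p : ℝ) (hp : 1 ≤ p)
    (N : Type) [MetricSpace N] [CompactSpace N] [MeasurableSpace N] [BorelSpace N]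
    (u : Euc m → N) (hu : Measurable u)
    (x' : Euc m) (t : ℝ) (ht : 0 < t) (δ : ℝ) (hδ : 0 ≤ δ) :
    (volume (ball x' t))⁻¹ * ∫⁻ z in ball x' t, MOsharp p δ u z t
      ≤ 2 ^ (2 * m) * MO p δ u x' (2 * t) := by
  have hV : volume (ball x' t) ≠ 0 := (measure_ball_pos volume x' ht).ne'
  have hscale : (2 : ℝ≥0∞) ^ (2 * m) *
      ((volume (ball x' (2 * t)))⁻¹ * (volume (ball x' (2 * t)))⁻¹) =
      (volume (ball x' t))⁻¹ * (volume (ball x' t))⁻¹ := by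
    have h2 : (2 : ℝ≥0∞) ^ m ≠ 0 := by simp
    have h2' : (2 : ℝ≥0∞) ^ m ≠ ∞ := by simp
    rw [volume_ball_two_mul, ENNReal.mul_inv (Or.inl h2) (Or.inl h2'), two_mul, pow_add]
    calc _ = ((2 : ℝ≥0∞) ^ m * (2 ^ m)⁻¹) * (2 ^ m * (2 ^ m)⁻¹) *
          ((volume (ball x' t))⁻¹ * (volume (ball x' t))⁻¹) := by ring
      _ = _ := by rw [ENNReal.mul_inv_cancel h2 h2', one_mul, one_mul]
  rw [MO, ← mul_assoc, hscale, mul_assoc]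
  gcongr
  have hsub : ∀ z ∈ ball x' t, ball z t ⊆ ball x' (2 * t) := fun z hz =>
    ball_subset_ball' (by linarith [mem_ball.1 hz])
  calc ∫⁻ z in ball x' t, MOsharp p δ u z t
      ≤ ∫⁻ z in ball x' t, (volume (ball x' t))⁻¹ * ∫⁻ y in ball x' (2 * t),
          ENNReal.ofReal (max (dist (u z) (u y) - δ) 0 ^ p) := by
        refine setLIntegral_mono' measurableSet_ball fun z hz => ?_
        have h := MOsharp_le_of_subset p δ u z t (hsub z hz)
        rwa [Measure.addHaar_ball_center volume z t,
          ← Measure.addHaar_ball_center volume x' t] at h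
    _ = (volume (ball x' t))⁻¹ * ∫⁻ z in ball x' t, ∫⁻ y in ball x' (2 * t),
          ENNReal.ofReal (max (dist (u z) (u y) - δ) 0 ^ p) :=
        lintegral_const_mul' _ _ (ENNReal.inv_ne_top.2 hV)
    _ ≤ _ := mul_le_mul_right (lintegral_mono_set (ball_subset_ball (by linarith))) _
end
end

section
/- Let m ≥ 1 and ν ≥ 1 be integers, p ∈ [1,∞), and fix φ ∈ C^∞(ℝ^m, ℝ) with support in the open unit ball and ∫_{ℝ^m} φ = 1. There exists a constant C ∈ (0,∞), depending only on m, p and φ, such that for every nonempty set Y ⊆ ℝ^ν, every bounded Borel measurable u : ℝ^m → ℝ^ν with u(x) ∈ Y for Lebesgue-almost every x ∈ ℝ^m, every δ ∈ [0,∞) and every x ∈ ℝ^{m+1}_+, the extension by averaging V of u satisfies dist(V(x), Y)^p ≤ C·(MO_{δ,p}u(x) + δ^p), where MO is the truncated mean oscillation taken with respect to the Euclidean distance of ℝ^ν. -/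
open MeasureTheory Metric Set
open scoped ENNReal Topology

noncomputable section

/-- Jensen's inequality for powers `p ≥ 1` of a nonnegative function on a probability space. -/
theorem lintegral_rpow_le_lintegral_rpow {α : Type*} [MeasurableSpace α] {μ : Measure α}
    [IsProbabilityMeasure μ] {p : ℝ} (hp : 1 ≤ p) {f : α → ℝ≥0∞} (hf : AEMeasurable f μ) :
    (∫⁻ a, f a ∂μ) ^ p ≤ ∫⁻ a, f a ^ p ∂μ := by
  have hp0 : 0 < p := zero_lt_one.trans_le hp
  have h := eLpNorm'_le_eLpNorm'_of_exponent_le zero_lt_one hp μ hf.aestronglyMeasurable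
  simp only [eLpNorm', enorm_eq_self, ENNReal.rpow_one, div_one] at h
  calc (∫⁻ a, f a ∂μ) ^ p ≤ ((∫⁻ a, f a ^ p ∂μ) ^ (1 / p)) ^ p :=
        ENNReal.rpow_le_rpow h hp0.le
    _ = ∫⁻ a, f a ^ p ∂μ := by
        rw [← ENNReal.rpow_mul, one_div_mul_cancel hp0.ne', ENNReal.rpow_one]

/-- The integral over the unit ball, after rescaling, is an average over a ball of radius `t`. -/
theorem setLIntegral_ball_comp_sub_smul {E : Type*} [NormedAddCommGroup E] [NormedSpace ℝ E]
    [FiniteDimensional ℝ E] [MeasurableSpace E] [BorelSpace E] (μ : Measure E)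
    [μ.IsAddHaarMeasure] {F : E → ℝ≥0∞} (hF : Measurable F) (x : E) {t : ℝ} (ht : 0 < t) :
    ∫⁻ z in ball (0 : E) 1, F (x - t • z) ∂μ =
      μ (ball 0 1) * ∫⁻ w, F w ∂ProbabilityTheory.cond μ (ball x t) := by
  have hmap : Measure.map (fun z : E => x - t • z) μ =
      ENNReal.ofReal (t ^ Module.finrank ℝ E)⁻¹ • μ := by
    have h : (fun z : E => x - t • z) = (fun z => x - z) ∘ (fun z => t • z) := rfl
    rw [h, ← Measure.map_map (by fun_prop) (by fun_prop), Measure.map_addHaar_smul μ ht.ne',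
      Measure.map_smul, (Measure.measurePreserving_sub_left μ x).map_eq,
      abs_of_nonneg (by positivity)]
  have hpre : (fun z : E => x - t • z) ⁻¹' ball x t = ball 0 1 := by
    ext z
    simp [norm_smul, abs_of_pos ht, ht]
  have h := setLIntegral_map (μ := μ) (measurableSet_ball (x := x) (ε := t)) hF
    (by fun_prop : Measurable fun z : E => x - t • z)
  rw [hpre, hmap, Measure.restrict_smul, lintegral_smul_measure] at h
  have hB : μ (ball (0 : E) 1) ≠ 0 := (measure_ball_pos μ 0 zero_lt_one).ne'
  have hB' : μ (ball (0 : E) 1) ≠ ∞ := measure_ball_lt_top.ne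
  rw [← h, ProbabilityTheory.cond, lintegral_smul_measure, Measure.addHaar_ball_of_pos μ x ht,
    smul_eq_mul, smul_eq_mul, ← mul_assoc, ENNReal.mul_inv (Or.inr hB') (Or.inr hB),
    mul_left_comm, ENNReal.mul_inv_cancel hB hB', mul_one,
    ENNReal.ofReal_inv_of_pos (by positivity)]

theorem MO_eq_lintegral_cond {N : Type} [PseudoMetricSpace N] {m : ℕ} {p : ℝ} (hp : 0 ≤ p)
    (δ : ℝ) (u : Euc m → N) (x : Euc m) {r : ℝ} (hr : 0 < r) :
    MO p δ u x r = ∫⁻ y, ∫⁻ z, ENNReal.ofReal (max (dist (u y) (u z) - δ) 0) ^ p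
      ∂ProbabilityTheory.cond volume (ball x r) ∂ProbabilityTheory.cond volume (ball x r) := by
  have hB : (volume (ball x r))⁻¹ ≠ ∞ :=
    ENNReal.inv_ne_top.2 (measure_ball_pos volume x hr).ne'
  simp only [MO, ProbabilityTheory.cond, lintegral_smul_measure, smul_eq_mul,
    lintegral_const_mul' _ _ hB, mul_assoc,
    ENNReal.ofReal_rpow_of_nonneg (le_max_right _ _) hp]

/-- The distance of the averaged extension to a fixed vector is controlled by the mean distance
of `u` to that vector. -/
theorem enorm_avgExt_sub_le {m ν : ℕ} {φ : Euc m → ℝ}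
    (hφsupp : tsupport φ ⊆ ball (0 : Euc m) 1) (hφint : ∫ z, φ z = 1) {K : ℝ}
    (hK : ∀ z, ‖φ z‖ ≤ K) {u : Euc m → Euc ν} (hu : Measurable u) {M : ℝ}
    (hM : ∀ x, ‖u x‖ ≤ M) (x : Euc m) {t : ℝ} (ht : 0 < t) (v : Euc ν) :
    ‖avgExt φ u (x, t) - v‖ₑ ≤ ENNReal.ofReal K * (volume (ball (0 : Euc m) 1) *
      ∫⁻ w, edist v (u w) ∂ProbabilityTheory.cond volume (ball x t)) := by
  have hφi : Integrable φ := by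
    by_contra h
    simp [integral_undef h] at hφint
  have hmeas : Measurable fun z => u (x - t • z) := hu.comp (by fun_prop)
  have hint : Integrable fun z => φ z • u (x - t • z) :=
    hφi.smul_bdd M hmeas.aestronglyMeasurable (Filter.Eventually.of_forall fun z => hM _)
  have heq : avgExt φ u (x, t) - v = ∫ z, φ z • (u (x - t • z) - v) := by
    simp only [smul_sub]
    rw [integral_sub hint (hφi.smul_const v), integral_smul_const, hφint, one_smul, avgExt]
  rw [heq, ← setLIntegral_ball_comp_sub_smul volume (by fun_prop) x ht,
    ← lintegral_const_mul' _ _ ENNReal.ofReal_ne_top,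
    ← lintegral_indicator measurableSet_ball]
  refine (enorm_integral_le_lintegral_enorm _).trans (lintegral_mono fun z => ?_)
  by_cases hz : z ∈ ball (0 : Euc m) 1
  · rw [indicator_of_mem hz, enorm_smul, edist_comm, edist_eq_enorm_sub, ← ofReal_norm (φ z)]
    gcongr
    exact hK z
  · simp [image_eq_zero_of_notMem_tsupport fun h => hz (hφsupp h)]

/-- Estimate (2.5): distance of the averaged extension to the essential range,
`dist(V(x), Y)^p ≤ C (MO_{δ,p}u(x) + δ^p)`. -/
theorem dist_avgExt_le (m : ℕ) (hm : 1 ≤ m) (p : ℝ) (hp : 1 ≤ p)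
    (φ : Euc m → ℝ) (hφ : ContDiff ℝ (⊤ : ℕ∞) φ)
    (hφsupp : tsupport φ ⊆ ball (0 : Euc m) 1) (hφint : ∫ z, φ z = 1) :
    ∃ C : ℝ, 0 < C ∧
      ∀ (ν : ℕ), 1 ≤ ν →
      ∀ (Y : Set (Euc ν)), Y.Nonempty →
      ∀ (u : Euc m → Euc ν), Measurable u → (∃ M : ℝ, ∀ x, ‖u x‖ ≤ M) →
        (∀ᵐ x, u x ∈ Y) →
      ∀ (δ : ℝ), 0 ≤ δ →
      ∀ (x' : Euc m) (t : ℝ), 0 < t →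
      ENNReal.ofReal (Metric.infDist (avgExt φ u (x', t)) Y ^ p)
        ≤ ENNReal.ofReal C * (MO p δ u x' t + ENNReal.ofReal (δ ^ p)) := by
  have hp0 : 0 ≤ p := zero_le_one.trans hp
  obtain ⟨K, hK⟩ := (HasCompactSupport.of_support_subset_isCompact
    (isCompact_closedBall (0 : Euc m) 1) ((subset_tsupport φ).trans
      (hφsupp.trans ball_subset_closedBall))).exists_bound_of_continuous hφ.continuous
  have hK0 : 0 ≤ K := (norm_nonneg _).trans (hK 0)
  set b : ℝ := volume.real (ball (0 : Euc m) 1)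
  have hb0 : 0 < b := ENNReal.toReal_pos
    (measure_ball_pos volume 0 zero_lt_one).ne' measure_ball_lt_top.ne
  have hbv : volume (ball (0 : Euc m) 1) = ENNReal.ofReal b :=
    (ENNReal.ofReal_toReal measure_ball_lt_top.ne).symm
  refine ⟨((K + 1) * b) ^ p * 2 ^ (p - 1), by positivity, ?_⟩
  intro ν _ Y _ u hu ⟨M, hM⟩ hY δ hδ x t ht
  set V := avgExt φ u (x, t)
  set μ := ProbabilityTheory.cond volume (ball x t)
  have : IsProbabilityMeasure μ := ProbabilityTheory.cond_isProbabilityMeasure_of_finite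
    (measure_ball_pos volume x ht).ne' measure_ball_lt_top.ne
  have hYμ : ∀ᵐ y ∂μ, u y ∈ Y := ProbabilityTheory.cond_absolutelyContinuous.ae_le hY
  set C : ℝ≥0∞ := ENNReal.ofReal (((K + 1) * b) ^ p * 2 ^ (p - 1)) with hC
  have hC' : C = ENNReal.ofReal ((K + 1) * b) ^ p * 2 ^ (p - 1) := by
    rw [hC, ENNReal.ofReal_mul (by positivity),
      ENNReal.ofReal_rpow_of_nonneg (by positivity) hp0,
      ← ENNReal.ofReal_rpow_of_nonneg zero_le_two (by linarith), ENNReal.ofReal_ofNat]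
  have hCtop : C ≠ ∞ := ENNReal.ofReal_ne_top
  let g : Euc m → Euc m → ℝ≥0∞ := fun y w => ENNReal.ofReal (max (dist (u y) (u w) - δ) 0)
  have hg (y) : Measurable (g y) := by fun_prop
  have key : ∀ᵐ y ∂μ, ENNReal.ofReal (infDist V Y ^ p) ≤
      C * (∫⁻ w, g y w ^ p ∂μ + ENNReal.ofReal (δ ^ p)) := by
    filter_upwards [hYμ] with y hy
    have hedist (w) : edist (u y) (u w) ≤ g y w + ENNReal.ofReal δ := by
      rw [edist_dist, ← ENNReal.ofReal_add (le_max_right _ _) hδ]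
      exact ENNReal.ofReal_le_ofReal (by linarith [le_max_left (dist (u y) (u w) - δ) 0])
    have h1 : ENNReal.ofReal (infDist V Y) ≤
        ENNReal.ofReal ((K + 1) * b) * (∫⁻ w, g y w ∂μ + ENNReal.ofReal δ) :=
      calc ENNReal.ofReal (infDist V Y) ≤ ‖V - u y‖ₑ := by
            rw [← ofReal_norm, ← dist_eq_norm]
            exact ENNReal.ofReal_le_ofReal (infDist_le_dist_of_mem hy)
        _ ≤ ENNReal.ofReal (K + 1) * (ENNReal.ofReal b * ∫⁻ w, edist (u y) (u w) ∂μ) := by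
            rw [← hbv]
            exact enorm_avgExt_sub_le hφsupp hφint
              (fun z => (hK z).trans (by linarith)) hu hM x ht (u y)
        _ ≤ ENNReal.ofReal ((K + 1) * b) * ∫⁻ w, (g y w + ENNReal.ofReal δ) ∂μ := by
            rw [ENNReal.ofReal_mul (by positivity), mul_assoc]
            gcongr with w
            exact hedist w
        _ = _ := by rw [lintegral_add_right _ measurable_const, lintegral_const, measure_univ,
              mul_one]
    rw [← ENNReal.ofReal_rpow_of_nonneg infDist_nonneg hp0]
    calc ENNReal.ofReal (infDist V Y) ^ p
        ≤ (ENNReal.ofReal ((K + 1) * b) * (∫⁻ w, g y w ∂μ + ENNReal.ofReal δ)) ^ p :=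
          ENNReal.rpow_le_rpow h1 hp0
      _ = ENNReal.ofReal ((K + 1) * b) ^ p * (∫⁻ w, g y w ∂μ + ENNReal.ofReal δ) ^ p :=
          ENNReal.mul_rpow_of_nonneg _ _ hp0
      _ ≤ ENNReal.ofReal ((K + 1) * b) ^ p *
            (2 ^ (p - 1) * ((∫⁻ w, g y w ∂μ) ^ p + ENNReal.ofReal δ ^ p)) := by
          gcongr
          exact ENNReal.rpow_add_le_mul_rpow_add_rpow _ _ hp
      _ ≤ C * (∫⁻ w, g y w ^ p ∂μ + ENNReal.ofReal (δ ^ p)) := by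
          rw [hC', mul_assoc, ENNReal.ofReal_rpow_of_nonneg hδ hp0]
          gcongr
          exact lintegral_rpow_le_lintegral_rpow hp (hg y).aemeasurable
  have h := lintegral_mono_ae key
  rwa [lintegral_const, measure_univ, mul_one, lintegral_const_mul' _ _ hCtop,
    lintegral_add_right _ measurable_const, lintegral_const, measure_univ, mul_one,
    ← MO_eq_lintegral_cond hp0 δ u x ht] at h
end
end
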